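/- For every integer k ≥ 0 and every signed permutation matrix χ, the block matrices [[0,0,0,α_k],[0,0,χ,0],[0,χᵗ,0,0],[α_k,0,0,0]] and [[0,0,0,β_k],[0,0,χ,0],[0,χᵗ,0,0],[β_k,0,0,0]] are I-Wilf equivalent: for every n ≥ 1 the number of signed involutions in SI_n avoiding the first pattern equals the number avoiding the second. -/

import Mathlib

open Matrix

/-- A signed permutation matrix: entries in {0,1,-1}, with exactly one nonzero
entry in each row and each column. -/
def IsSignedPermMatrix {n : ℕ} (M : Matrix (Fin n) (Fin n) ℤ) : Prop :=
  (∀ i j, M i j = 0 ∨ M i j = 1 ∨ M i j = -1) ∧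
  (∀ i, ∃! j, M i j ≠ 0) ∧
  (∀ j, ∃! i, M i j ≠ 0)

/-- `M` contains the pattern `τ`: some `k×k` submatrix of `M`, taken with rows
and columns in increasing order, equals `τ`. -/
def ContainsPattern {n k : ℕ} (M : Matrix (Fin n) (Fin n) ℤ)
    (τ : Matrix (Fin k) (Fin k) ℤ) : Prop :=
  ∃ r c : Fin k → Fin n, StrictMono r ∧ StrictMono c ∧
    ∀ a b, M (r a) (c b) = τ a b

/-- Block diagonal matrix [[A,0],[0,B]]. -/
def blockDiag2 {a b : ℕ} (A : Matrix (Fin a) (Fin a) ℤ) (B : Matrix (Fin b) (Fin b) ℤ) :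
    Matrix (Fin (a + b)) (Fin (a + b)) ℤ :=
  Matrix.reindex finSumFinEquiv finSumFinEquiv
    (Matrix.fromBlocks A (0 : Matrix (Fin a) (Fin b) ℤ) (0 : Matrix (Fin b) (Fin a) ℤ) B)

/-- Block diagonal matrix with three blocks. -/
def blockDiag3 {a b c : ℕ} (A : Matrix (Fin a) (Fin a) ℤ) (B : Matrix (Fin b) (Fin b) ℤ)
    (C : Matrix (Fin c) (Fin c) ℤ) : Matrix (Fin (a + b + c)) (Fin (a + b + c)) ℤ :=
  blockDiag2 (blockDiag2 A B) C

/-- Block antidiagonal matrix [[0,A],[B,0]]. -/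
def antiBlock2 {a b : ℕ} (A : Matrix (Fin a) (Fin a) ℤ) (B : Matrix (Fin b) (Fin b) ℤ) :
    Matrix (Fin (a + b)) (Fin (a + b)) ℤ :=
  Matrix.reindex finSumFinEquiv (finSumFinEquiv.trans (finCongr (Nat.add_comm b a)))
    (Matrix.fromBlocks (0 : Matrix (Fin a) (Fin b) ℤ) A B (0 : Matrix (Fin b) (Fin a) ℤ))

/-- For a signed permutation matrix σ, the involution σ' = [[0,σ],[σᵗ,0]]. -/
def primePat {k : ℕ} (σ : Matrix (Fin k) (Fin k) ℤ) :
    Matrix (Fin (k + k)) (Fin (k + k)) ℤ :=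
  Matrix.reindex finSumFinEquiv finSumFinEquiv
    (Matrix.fromBlocks (0 : Matrix (Fin k) (Fin k) ℤ) σ σ.transpose
      (0 : Matrix (Fin k) (Fin k) ℤ))

/-- For a signed permutation matrix σ, the involution σ'' = [[0,0,σ],[0,1,0],[σᵗ,0,0]]. -/
def doublePrimePat {k : ℕ} (σ : Matrix (Fin k) (Fin k) ℤ) :
    Matrix (Fin (k + (1 + k))) (Fin (k + (1 + k))) ℤ :=
  Matrix.reindex ((Equiv.sumCongr (Equiv.refl (Fin k)) finSumFinEquiv).trans finSumFinEquiv)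
    ((Equiv.sumCongr (Equiv.refl (Fin k)) finSumFinEquiv).trans finSumFinEquiv)
    (Matrix.fromBlocks
      (0 : Matrix (Fin k) (Fin k) ℤ)
      (Matrix.of fun (i : Fin k) (j : Fin 1 ⊕ Fin k) =>
        Sum.elim (fun _ => (0 : ℤ)) (fun j' => σ i j') j)
      (Matrix.of fun (i : Fin 1 ⊕ Fin k) (j : Fin k) =>
        Sum.elim (fun _ => (0 : ℤ)) (fun i' => σ.transpose i' j) i)
      (Matrix.fromBlocks (1 : Matrix (Fin 1) (Fin 1) ℤ) 0 0 (0 : Matrix (Fin k) (Fin k) ℤ)))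

/-- β_k, the antidiagonal k×k permutation matrix (pattern k(k-1)…1). -/
def betaMat (k : ℕ) : Matrix (Fin k) (Fin k) ℤ :=
  Matrix.of fun i j => if (i : ℕ) + (j : ℕ) + 1 = k then 1 else 0

/-- |SI_n(τ)|: the number of τ-avoiding signed involutions of size n. -/
noncomputable def SIAvoidCount (n : ℕ) {k : ℕ} (τ : Matrix (Fin k) (Fin k) ℤ) : ℕ :=
  {M : Matrix (Fin n) (Fin n) ℤ |
    IsSignedPermMatrix M ∧ M.IsSymm ∧ ¬ ContainsPattern M τ}.ncard

/-- |B_n(τ)|: the number of τ-avoiding signed permutations of size n. -/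
noncomputable def BAvoidCount (n : ℕ) {k : ℕ} (τ : Matrix (Fin k) (Fin k) ℤ) : ℕ :=
  {M : Matrix (Fin n) (Fin n) ℤ | IsSignedPermMatrix M ∧ ¬ ContainsPattern M τ}.ncard

/-- A partition, encoded by its sequence of row lengths. -/
def IsPartition (f : ℕ → ℕ) : Prop := Antitone f ∧ ∃ N, f N = 0

/-- `g` is `f` or is obtained from `f` by adding a single box. -/
def AddsBox (f g : ℕ → ℕ) : Prop := g = f ∨ ∃ r, g r = f r + 1 ∧ ∀ s, s ≠ r → g s = f s

/-- Fomin's local growth rule on a unit square with lower left label `ρ`, intermediate labels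
`μ` and `ν`, and upper right label `lam`; the proposition `X` says that the square is marked. -/
structure GrowthRule (ρ μ ν lam : ℕ → ℕ) (X : Prop) : Prop where
  left : AddsBox ρ μ
  right : AddsBox ρ ν
  marked : X → μ = ρ ∧ ν = ρ
  unmarked_zero : ¬ X → lam 0 = max (μ 0) (ν 0)
  marked_zero : X → lam 0 = max (μ 0) (ν 0) + 1
  succ : ∀ r, lam (r + 1) + ρ r = max (μ (r + 1)) (ν (r + 1)) + min (μ r) (ν r)

lemma AddsBox.le {f g : ℕ → ℕ} (h : AddsBox f g) (r : ℕ) : f r ≤ g r ∧ g r ≤ f r + 1 := by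
  rcases h with rfl | ⟨a, ha, hb⟩
  · omega
  · by_cases hr : r = a
    · subst hr; omega
    · have := hb r hr; omega

lemma AddsBox.eq_of_lt {f g : ℕ → ℕ} (h : AddsBox f g) {r : ℕ} (hr : f r < g r) (s : ℕ)
    (hs : s ≠ r) : g s = f s := by
  rcases h with rfl | ⟨a, -, hb⟩
  · rfl
  · have : r = a := by
      by_contra hra
      have := hb r hra
      omega
    exact hb s (this ▸ hs)

lemma GrowthRule.symm {ρ μ ν lam : ℕ → ℕ} {X : Prop} (h : GrowthRule ρ μ ν lam X) :
    GrowthRule ρ ν μ lam X where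
  left := h.right
  right := h.left
  marked hX := (h.marked hX).symm
  unmarked_zero hX := by rw [h.unmarked_zero hX, max_comm]
  marked_zero hX := by rw [h.marked_zero hX, max_comm]
  succ r := by rw [h.succ r, max_comm, min_comm]

lemma GrowthRule.eq_of_left_eq {ρ μ ν lam : ℕ → ℕ} {X : Prop} (h : GrowthRule ρ μ ν lam X)
    (hX : ¬ X) (hμ : μ = ρ) : lam = ν := by
  funext r
  cases r with
  | zero => have := h.unmarked_zero hX; have := h.right.le 0; subst hμ; omega
  | succ r =>
    have := h.succ r; have := h.right.le r; have := h.right.le (r + 1); subst hμ; omega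

lemma GrowthRule.addsBox_of_marked {ρ μ ν lam : ℕ → ℕ} {X : Prop} (h : GrowthRule ρ μ ν lam X)
    (hX : X) : lam 0 = ν 0 + 1 ∧ ∀ s, s ≠ 0 → lam s = ν s := by
  obtain ⟨rfl, rfl⟩ := h.marked hX
  refine ⟨by have := h.marked_zero hX; omega, fun s hs => ?_⟩
  obtain ⟨s, rfl⟩ := Nat.exists_eq_succ_of_ne_zero hs
  have := h.succ s
  simp only [Nat.succ_eq_add_one]
  omega

lemma GrowthRule.addsBox_of_ne {ρ μ ν lam : ℕ → ℕ} {X : Prop} (h : GrowthRule ρ μ ν lam X)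
    (hX : ¬ X) (hμ : μ ≠ ρ) : ∃ r, lam r = ν r + 1 ∧ ∀ s, s ≠ r → lam s = ν s := by
  obtain ⟨a, ha, hb⟩ := h.left.resolve_left hμ
  rcases h.right with rfl | ⟨c, hc, hd⟩
  · rw [h.symm.eq_of_left_eq hX rfl]
    exact ⟨a, ha, hb⟩
  · have h0 := h.unmarked_zero hX
    by_cases hac : a = c
    · subst hac
      have hμν : ∀ r, μ r = ν r := fun r => by
        by_cases hr : r = a
        · rw [hr, ha, hc]
        · rw [hb r hr, hd r hr]
      refine ⟨a + 1, ?_, fun s hs => ?_⟩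
      · have := h.succ a; have := hμν a; have := hμν (a + 1); omega
      · cases s with
        | zero => have := hμν 0; omega
        | succ s =>
          have := h.succ s; have := hμν s; have := hμν (s + 1); have := hd s (by omega)
          omega
    · have key : ∀ s, s ≠ a → s ≠ c → μ s = ρ s ∧ ν s = ρ s := fun s h1 h2 => ⟨hb s h1, hd s h2⟩
      have hmin : ∀ s, min (μ s) (ν s) = ρ s := fun s => by
        by_cases h1 : s = a
        · subst h1; have := hd s hac; omega
        · have := hb s h1; have := h.right.le s; omega
      have hmax : ∀ s, lam s = max (μ s) (ν s) := fun s => by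
        cases s with
        | zero => exact h0
        | succ s => have := h.succ s; have := hmin s; omega
      refine ⟨a, ?_, fun s hs => ?_⟩
      · have := hmax a; have := hd a hac; omega
      · have := hmax s; have := hb s hs; have := h.right.le s; omega

lemma GrowthRule.eq_right_iff {ρ μ ν lam : ℕ → ℕ} {X : Prop} (h : GrowthRule ρ μ ν lam X) :
    lam = ν ↔ μ = ρ ∧ ¬ X := by
  constructor
  · intro hl
    have hX : ¬ X := fun hX => by have := (h.addsBox_of_marked hX).1; rw [hl] at this; omega
    refine ⟨?_, hX⟩
    by_contra hμ
    obtain ⟨r, hr, -⟩ := h.addsBox_of_ne hX hμ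
    rw [hl] at hr
    omega
  · exact fun ⟨hμ, hX⟩ => h.eq_of_left_eq hX hμ

lemma GrowthRule.addsBox_right {ρ μ ν lam : ℕ → ℕ} {X : Prop} (h : GrowthRule ρ μ ν lam X) :
    AddsBox ν lam := by
  by_cases hX : X
  · exact Or.inr ⟨0, h.addsBox_of_marked hX⟩
  · by_cases hμ : μ = ρ
    · exact Or.inl (h.eq_of_left_eq hX hμ)
    · exact Or.inr (h.addsBox_of_ne hX hμ)

lemma GrowthRule.isPartition {ρ μ ν lam : ℕ → ℕ} {X : Prop} (h : GrowthRule ρ μ ν lam X)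
    (hρ : IsPartition ρ) (hμ : IsPartition μ) (hν : IsPartition ν) : IsPartition lam := by
  constructor
  · apply antitone_nat_of_succ_le
    intro r
    have h1 := hρ.1 (Nat.le_succ r)
    have h2 := hμ.1 (Nat.le_succ r)
    have h3 := hν.1 (Nat.le_succ r)
    have h4 := h.succ r
    have h5 := h.addsBox_right.le r
    have h6 := h.symm.addsBox_right.le r
    have h7 := h.left.le r
    have h8 := h.right.le r
    have h9 := h.left.le (r + 1)
    have h10 := h.right.le (r + 1)
    have h11 := fun hr => h.left.eq_of_lt (r := r) hr (r + 1) (by omega)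
    have h12 := fun hr => h.right.eq_of_lt (r := r) hr (r + 1) (by omega)
    have h13 := h.addsBox_right.le (r + 1)
    simp only [Nat.succ_eq_add_one] at *
    omega
  · obtain ⟨N, hN⟩ := hμ.2
    obtain ⟨N', hN'⟩ := hν.2
    refine ⟨max N N' + 1, ?_⟩
    have h1 := h.succ (max N N')
    have h2 := hμ.1 (le_max_left N N')
    have h3 := hν.1 (le_max_right N N')
    have h4 := hμ.1 (Nat.le_succ (max N N'))
    have h5 := hν.1 (Nat.le_succ (max N N'))
    simp only [Nat.succ_eq_add_one] at *
    omega

lemma GrowthRule.unique_top {ρ μ ν lam lam' : ℕ → ℕ} {X : Prop} (h : GrowthRule ρ μ ν lam X)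
    (h' : GrowthRule ρ μ ν lam' X) : lam = lam' := by
  funext r
  cases r with
  | zero =>
    by_cases hX : X
    · rw [h.marked_zero hX, h'.marked_zero hX]
    · rw [h.unmarked_zero hX, h'.unmarked_zero hX]
  | succ r => have := h.succ r; have := h'.succ r; omega

lemma GrowthRule.unique_bottom {ρ ρ' μ ν lam : ℕ → ℕ} {X X' : Prop}
    (h : GrowthRule ρ μ ν lam X) (h' : GrowthRule ρ' μ ν lam X') : ρ = ρ' ∧ (X ↔ X') := by
  constructor
  · funext r
    have := h.succ r; have := h'.succ r; omega
  · have h1 := h.marked_zero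
    have h2 := h.unmarked_zero
    have h3 := h'.marked_zero
    have h4 := h'.unmarked_zero
    by_cases hX : X <;> by_cases hX' : X' <;> simp_all

lemma exists_growthRule {μ ν lam : ℕ → ℕ} (hμ : IsPartition μ) (hν : IsPartition ν)
    (hl : IsPartition lam) (h1 : AddsBox μ lam) (h2 : AddsBox ν lam) :
    ∃ ρ X, IsPartition ρ ∧ GrowthRule ρ μ ν lam X := by
  rcases h1 with rfl | ⟨a, ha, hb⟩
  · refine ⟨ν, False, hν, h2, Or.inl rfl, by simp, fun _ => ?_, by simp, fun r => ?_⟩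
    · have := h2.le 0; omega
    · have := h2.le r; have := h2.le (r + 1); omega
  have h1 : AddsBox μ lam := Or.inr ⟨a, ha, hb⟩
  rcases h2 with rfl | ⟨c, hc, hd⟩
  · refine ⟨μ, False, hμ, Or.inl rfl, h1, by simp, fun _ => ?_, by simp, fun r => ?_⟩
    · have := h1.le 0; omega
    · have := h1.le r; have := h1.le (r + 1); omega
  have h2 : AddsBox ν lam := Or.inr ⟨c, hc, hd⟩
  by_cases hac : a = c
  · subst hac
    have hμν : μ = ν := by
      funext r
      by_cases hr : r = a
      · subst hr; omega
      · rw [← hb r hr, ← hd r hr]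
    subst hμν
    cases a with
    | zero =>
      refine ⟨μ, True, hμ, Or.inl rfl, Or.inl rfl, by simp, by simp, fun _ => by omega,
        fun r => ?_⟩
      have := hb (r + 1) (by omega)
      omega
    | succ a =>
      have hlt : μ (a + 1) < μ a := by
        have := hl.1 (Nat.le_succ a); have := hb a (by omega)
        simp only [Nat.succ_eq_add_one] at *
        omega
      have hu : ∀ s, Function.update μ a (μ a - 1) s = if s = a then μ a - 1 else μ s := by
        intro s
        simp [Function.update_apply]
      have hadd : AddsBox (Function.update μ a (μ a - 1)) μ := by
        refine Or.inr ⟨a, ?_, fun s hs => ?_⟩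
        · rw [hu, if_pos rfl]; omega
        · rw [hu, if_neg hs]
      refine ⟨Function.update μ a (μ a - 1), False, ⟨?_, ?_⟩, hadd, hadd, by simp, fun _ => ?_,
        by simp, fun r => ?_⟩
      · apply antitone_nat_of_succ_le
        intro r
        have := hμ.1 (Nat.le_succ r)
        simp only [Nat.succ_eq_add_one] at *
        rw [hu, hu]
        split_ifs with h3 h4 <;> try subst h3
        all_goals try subst_vars
        all_goals omega
      · obtain ⟨N, hN⟩ := hμ.2
        exact ⟨N, by rw [hu]; split_ifs with h <;> [(subst h; omega); exact hN]⟩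
      · have := hb 0 (by omega); omega
      · rw [hu]
        split_ifs with h3
        · subst h3; omega
        · have := hb (r + 1) (by omega); omega
  · have hmax : ∀ s, lam s = max (μ s) (ν s) := fun s => by
      by_cases h3 : s = a
      · subst h3; have := hd s hac; omega
      · have := hb s h3; have := h2.le s; omega
    refine ⟨fun r => min (μ r) (ν r), False, ⟨hμ.1.inf hν.1, ?_⟩, Or.inr ⟨c, ?_, ?_⟩,
      Or.inr ⟨a, ?_, ?_⟩, by simp, fun _ => hmax 0, by simp, fun r => ?_⟩
    · obtain ⟨N, hN⟩ := hμ.2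
      exact ⟨N, by simp [hN]⟩
    · have := hb c (Ne.symm hac); simp only; omega
    · intro s hs; have := hd s hs; have := h1.le s; simp only; omega
    · have := hd a hac; simp only; omega
    · intro s hs; have := hb s hs; have := h2.le s; simp only; omega
    · have := hmax (r + 1); omega

/-- The conjugate of a partition. -/
noncomputable def conjugate (f : ℕ → ℕ) (c : ℕ) : ℕ := sInf {r | f r ≤ c}

lemma lt_conjugate_iff {f : ℕ → ℕ} (hf : IsPartition f) (r c : ℕ) : r < conjugate f c ↔ c < f r := by
  constructor
  · intro h
    by_contra hc
    exact absurd (Nat.sInf_le (s := {r | f r ≤ c}) (not_lt.1 hc)) (not_le.2 h)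
  · intro h
    by_contra hc
    obtain ⟨N, hN⟩ := hf.2
    have h1 : f (conjugate f c) ≤ c := Nat.sInf_mem (s := {r | f r ≤ c}) ⟨N, by simp [hN]⟩
    have h2 := hf.1 (not_lt.1 hc)
    omega

lemma conjugate_isPartition {f : ℕ → ℕ} (hf : IsPartition f) : IsPartition (conjugate f) := by
  constructor
  · intro c d hcd
    by_contra h
    have h1 := (lt_conjugate_iff hf _ _).1 (not_le.1 h)
    have h2 := (lt_conjugate_iff hf (conjugate f c) c).2 (by omega)
    omega
  · exact ⟨f 0, by
      by_contra h
      have := (lt_conjugate_iff hf 0 (f 0)).1 (Nat.pos_of_ne_zero h)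
      omega⟩

lemma conjugate_conjugate {f : ℕ → ℕ} (hf : IsPartition f) : conjugate (conjugate f) = f := by
  funext r
  apply eq_of_forall_lt_iff
  intro c
  rw [lt_conjugate_iff (conjugate_isPartition hf), lt_conjugate_iff hf]

lemma conjugate_injective {f g : ℕ → ℕ} (hf : IsPartition f) (hg : IsPartition g) :
    conjugate f = conjugate g ↔ f = g :=
  ⟨fun h => by rw [← conjugate_conjugate hf, h, conjugate_conjugate hg], fun h => by rw [h]⟩

lemma isPartition_zero : IsPartition 0 := ⟨antitone_const, 0, rfl⟩

lemma conjugate_zero : conjugate 0 = 0 := by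
  funext c
  by_contra h
  have := (lt_conjugate_iff isPartition_zero 0 c).1 (Nat.pos_of_ne_zero h)
  simp at this

lemma addsBox_conjugate {f g : ℕ → ℕ} (h : AddsBox f g) (hf : IsPartition f) (hg : IsPartition g) :
    AddsBox (conjugate f) (conjugate g) := by
  rcases h with rfl | ⟨a, ha, hb⟩
  · exact Or.inl rfl
  have hlt : ∀ r c, r < conjugate g c ↔ r < conjugate f c ∨ (r = a ∧ c = f a) := by
    intro r c
    rw [lt_conjugate_iff hf, lt_conjugate_iff hg]
    by_cases hr : r = a
    · subst hr; omega
    · rw [hb r hr]; tauto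
  refine Or.inr ⟨f a, ?_, fun c hc => ?_⟩
  · have h1 := hlt a (f a)
    have h2 := lt_conjugate_iff hf a (f a)
    have h3 := hlt (conjugate f (f a)) (f a)
    have h4 := hlt (conjugate f (f a) + 1) (f a)
    omega
  · apply eq_of_forall_lt_iff
    intro r
    rw [hlt]
    tauto

/-- Every row and every column contains at most one marked cell. -/
structure IsPartialPerm (T : ℕ → ℕ → Prop) : Prop where
  row : ∀ {i j j'}, T i j → T i j' → j = j'
  col : ∀ {i i' j}, T i j → T i' j → i = i'

lemma IsPartialPerm.swap {T : ℕ → ℕ → Prop} (h : IsPartialPerm T) :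
    IsPartialPerm (Function.swap T) :=
  ⟨fun h1 h2 => h.col h1 h2, fun h1 h2 => h.row h1 h2⟩

open Classical in
/-- The length of a longest increasing chain of marked cells in the rectangle `[0, i) × [0, j)`. -/
noncomputable def chainLen (T : ℕ → ℕ → Prop) : ℕ → ℕ → ℕ
  | 0, _ => 0
  | _ + 1, 0 => 0
  | i + 1, j + 1 =>
    max (chainLen T i (j + 1)) (chainLen T (i + 1) j) + if T i j then 1 else 0

section chainLen

variable {T : ℕ → ℕ → Prop}

@[simp] lemma chainLen_zero_left (j : ℕ) : chainLen T 0 j = 0 := by simp [chainLen]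

@[simp] lemma chainLen_zero_right (i : ℕ) : chainLen T i 0 = 0 := by cases i <;> simp [chainLen]

lemma chainLen_succ_of_mem {i j : ℕ} (h : T i j) : chainLen T (i + 1) (j + 1) =
    max (chainLen T (i + 1) j) (chainLen T i (j + 1)) + 1 := by
  rw [chainLen, if_pos h, max_comm]

lemma chainLen_succ_of_not_mem {i j : ℕ} (h : ¬ T i j) : chainLen T (i + 1) (j + 1) =
    max (chainLen T (i + 1) j) (chainLen T i (j + 1)) := by
  rw [chainLen, if_neg h, max_comm, add_zero]

lemma chainLen_swap (i j : ℕ) : chainLen (Function.swap T) j i = chainLen T i j := by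
  induction i generalizing j with
  | zero => simp
  | succ i ihi =>
    induction j with
    | zero => simp
    | succ j ihj =>
      rw [chainLen, chainLen, ihi, ihj, max_comm]

lemma chainLen_mono_right (i j : ℕ) : chainLen T i j ≤ chainLen T i (j + 1) := by
  cases i with
  | zero => simp
  | succ i => rw [chainLen]; omega

lemma chainLen_mono_left (i j : ℕ) : chainLen T i j ≤ chainLen T (i + 1) j := by
  simp only [← chainLen_swap (T := T)]
  exact chainLen_mono_right j i

lemma chainLen_mono {i i' j j' : ℕ} (hi : i ≤ i') (hj : j ≤ j') :
    chainLen T i j ≤ chainLen T i' j' :=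
  (monotone_nat_of_le_succ (f := fun i => chainLen T i j)
    (fun i => chainLen_mono_left i j) hi).trans
    (monotone_nat_of_le_succ (f := chainLen T i') (chainLen_mono_right i') hj)

lemma chainLen_eq_of_row {i j : ℕ} (h : ∀ j' < j, ¬ T i j') :
    chainLen T (i + 1) j = chainLen T i j := by
  induction j with
  | zero => simp
  | succ j ih =>
    have h1 := chainLen_succ_of_not_mem (h j (by omega))
    have h2 := ih fun j' hj' => h j' (by omega)
    have h3 := chainLen_mono_right (T := T) i j
    omega

lemma chainLen_eq_left (hT : IsPartialPerm T) {i j : ℕ} (h : T i j) :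
    chainLen T (i + 1) j = chainLen T i j :=
  chainLen_eq_of_row fun _ hj' h' => hj'.ne (hT.row h' h)

lemma chainLen_eq_right (hT : IsPartialPerm T) {i j : ℕ} (h : T i j) :
    chainLen T i (j + 1) = chainLen T i j := by
  simp only [← chainLen_swap (T := T)]
  exact chainLen_eq_left hT.swap h

lemma chainLen_step_left (hT : IsPartialPerm T) (i j : ℕ) :
    chainLen T (i + 1) j ≤ chainLen T i j + 1 := by
  induction j with
  | zero => simp
  | succ j ih =>
    have h1 := chainLen_mono_right (T := T) i j
    by_cases h : T i j
    · have := chainLen_succ_of_mem h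
      have := chainLen_eq_left hT h
      omega
    · have := chainLen_succ_of_not_mem h
      omega

lemma chainLen_step_right (hT : IsPartialPerm T) (i j : ℕ) :
    chainLen T i (j + 1) ≤ chainLen T i j + 1 := by
  simp only [← chainLen_swap (T := T)]
  exact chainLen_step_left hT.swap j i

lemma exists_mem_column {i i' j : ℕ} (hi : i ≤ i') (h : chainLen T i j = chainLen T i (j + 1))
    (h' : chainLen T i' j < chainLen T i' (j + 1)) : ∃ p, i ≤ p ∧ p < i' ∧ T p j := by
  induction i', hi using Nat.le_induction with
  | base => omega
  | succ i' hi ih =>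
    by_cases hlt : chainLen T i' j < chainLen T i' (j + 1)
    · obtain ⟨p, h1, h2, h3⟩ := ih hlt
      exact ⟨p, h1, by omega, h3⟩
    · refine ⟨i', hi, by omega, ?_⟩
      by_contra hT
      have := chainLen_succ_of_not_mem hT
      have := chainLen_mono_left (T := T) i' j
      omega

lemma exists_mem_row {i j j' : ℕ} (hj : j ≤ j') (h : chainLen T i j = chainLen T (i + 1) j)
    (h1 : chainLen T i j' < chainLen T (i + 1) j') : ∃ q, j ≤ q ∧ q < j' ∧ T i q := by
  simp only [← chainLen_swap (T := T)] at h h1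
  exact exists_mem_column hj h h1

/-- Viennot's skeleton: the inner corners of the shadow lines of `T`. -/
def skeleton (T : ℕ → ℕ → Prop) (i j : ℕ) : Prop :=
  chainLen T i j < chainLen T (i + 1) j ∧ chainLen T i j < chainLen T i (j + 1)

lemma skeleton_swap : skeleton (Function.swap T) = Function.swap (skeleton T) := by
  funext i j
  simp only [skeleton, chainLen_swap, Function.swap, and_comm]

lemma skeleton.exists_mem_left {i j : ℕ} (h : skeleton T i j) : ∃ p < i, T p j := by
  obtain ⟨p, -, h1, h2⟩ := exists_mem_column (Nat.zero_le i) (by simp) h.2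
  exact ⟨p, h1, h2⟩

lemma skeleton.exists_mem_below {i j : ℕ} (h : skeleton T i j) : ∃ q < j, T i q := by
  obtain ⟨p, -, h1, h2⟩ := exists_mem_row (Nat.zero_le j) (by simp) h.1
  exact ⟨p, h1, h2⟩

lemma exists_mem_row_of_lt (hT : IsPartialPerm T) {i j j' : ℕ} (hj : j < j')
    (h : chainLen T i j < chainLen T i (j + 1)) (h' : chainLen T i j' < chainLen T (i + 1) j') :
    ∃ q, j < q ∧ q < j' ∧ T i q := by
  have hn : ¬ T i j := fun hm => by have := chainLen_eq_right hT hm; omega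
  refine exists_mem_row hj ?_ h'
  have := chainLen_succ_of_not_mem hn
  have := chainLen_step_left hT i j
  simp only [Nat.succ_eq_add_one]
  omega

lemma skeleton_row (hT : IsPartialPerm T) {i j j' : ℕ} (h : skeleton T i j)
    (h' : skeleton T i j') : j = j' := by
  wlog hj : j < j' generalizing j j'
  · by_contra hne
    exact hne (this h' h (by omega)).symm
  obtain ⟨q, h1, -, h2⟩ := exists_mem_row_of_lt hT hj h.2 h'.1
  obtain ⟨q', h3, h4⟩ := h.exists_mem_below
  have := hT.row h2 h4
  omega

lemma IsPartialPerm.skeleton (hT : IsPartialPerm T) : IsPartialPerm (skeleton T) := by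
  refine ⟨skeleton_row hT, fun {i i' j} h h' => ?_⟩
  have := skeleton_row hT.swap (i := j) (j := i) (j' := i')
  rw [skeleton_swap] at this
  exact this h h'

lemma lt_of_not_skeleton {i i' j : ℕ} (hi : i ≤ i')
    (h : chainLen T i j < chainLen T i (j + 1)) (hs : ∀ s, i ≤ s → s < i' → ¬ skeleton T s j) :
    chainLen T i' j < chainLen T i' (j + 1) := by
  induction i', hi using Nat.le_induction with
  | base => exact h
  | succ s hi ih =>
    have h1 := ih fun t ht ht' => hs t ht (by omega)
    by_contra h2
    have := chainLen_mono_left (T := T) s (j + 1)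
    exact hs s hi (by omega) ⟨by omega, h1⟩

lemma lt_of_not_skeleton' {i j j' : ℕ} (hj : j ≤ j')
    (h : chainLen T i j < chainLen T (i + 1) j) (hs : ∀ s, j ≤ s → s < j' → ¬ skeleton T i s) :
    chainLen T i j' < chainLen T (i + 1) j' := by
  simp only [← chainLen_swap (T := T)] at h ⊢
  refine lt_of_not_skeleton hj h fun s h1 h2 => ?_
  rw [skeleton_swap]
  exact hs s h1 h2

lemma exists_skeleton_of_decreasing {i i' j j' : ℕ} (h : T i j)
    (h' : T i' j') (hi : i < i') (hj : j' < j) :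
    ∃ s y, skeleton T s y ∧ i < s ∧ s ≤ i' ∧ j' < y ∧ y ≤ j := by
  by_contra! hno
  have h1 : chainLen T i' j < chainLen T i' (j + 1) := by
    refine lt_of_not_skeleton (Nat.succ_le_of_lt hi) ?_ fun s h1 h2 h3 => ?_
    · have := chainLen_succ_of_mem h
      simp only [Nat.succ_eq_add_one]
      omega
    · have := hno s j h3 (by omega) (by omega) hj
      omega
  have h2 : chainLen T i' j < chainLen T (i' + 1) j := by
    refine lt_of_not_skeleton' (Nat.succ_le_of_lt hj) ?_ fun s h1 h2 h3 => ?_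
    · have := chainLen_succ_of_mem h'
      simp only [Nat.succ_eq_add_one]
      omega
    · have := hno i' s h3 (by omega) (by omega) (by omega)
      omega
  have := hno i' j ⟨h2, h1⟩ hi le_rfl hj
  omega

lemma exists_mem_of_skeleton (hT : IsPartialPerm T) {s s' y y' : ℕ} (h : skeleton T s y)
    (h' : skeleton T s' y') (hs : s < s') (hy : y' < y) :
    ∃ p q, T p q ∧ s ≤ p ∧ p < s' ∧ y' ≤ q ∧ q < y := by
  by_cases hm : chainLen T s y' < chainLen T s (y' + 1)
  · obtain ⟨q, h1, h2, h3⟩ := exists_mem_row_of_lt hT hy hm h.1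
    exact ⟨s, q, h3, le_rfl, hs, h1.le, h2⟩
  · have := chainLen_mono_right (T := T) s y'
    obtain ⟨p, h1, h2, h3⟩ := exists_mem_column hs.le (by omega) h'.2
    exact ⟨p, y', h3, h1, h2, le_rfl, hy⟩

end chainLen

lemma strictMono_snoc {k : ℕ} {f : Fin k → ℕ} (hf : StrictMono f) {x : ℕ} (hx : ∀ a, f a < x) :
    StrictMono (Fin.snoc f x : Fin (k + 1) → ℕ) := by
  intro a b hab
  induction b using Fin.lastCases with
  | last =>
    induction a using Fin.lastCases with
    | last => exact absurd hab (lt_irrefl _)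
    | cast a => simpa using hx a
  | cast b =>
    induction a using Fin.lastCases with
    | last => exact absurd (hab.trans (Fin.castSucc_lt_last b)) (lt_irrefl _)
    | cast a => simpa using hf (by simpa using hab)

/-- `T` has an increasing chain of length `k` in the rectangle `[0, p) × [0, q)`. -/
def HasIncreasing (T : ℕ → ℕ → Prop) (k p q : ℕ) : Prop :=
  ∃ r c : Fin k → ℕ, StrictMono r ∧ StrictMono c ∧ ∀ a, T (r a) (c a) ∧ r a < p ∧ c a < q

/-- `T` has a decreasing chain of length `k` in the rectangle `[0, p) × [0, q)`. -/
def HasDecreasing (T : ℕ → ℕ → Prop) (k p q : ℕ) : Prop :=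
  ∃ r c : Fin k → ℕ, StrictMono r ∧ StrictAnti c ∧ ∀ a, T (r a) (c a) ∧ r a < p ∧ c a < q

lemma HasIncreasing.mono {T : ℕ → ℕ → Prop} {k p q p' q' : ℕ} (h : HasIncreasing T k p q)
    (hp : p ≤ p') (hq : q ≤ q') : HasIncreasing T k p' q' := by
  obtain ⟨r, c, hr, hc, h⟩ := h
  exact ⟨r, c, hr, hc, fun a => ⟨(h a).1, (h a).2.1.trans_le hp, (h a).2.2.trans_le hq⟩⟩

lemma HasDecreasing.mono {T : ℕ → ℕ → Prop} {k p q p' q' : ℕ} (h : HasDecreasing T k p q)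
    (hp : p ≤ p') (hq : q ≤ q') : HasDecreasing T k p' q' := by
  obtain ⟨r, c, hr, hc, h⟩ := h
  exact ⟨r, c, hr, hc, fun a => ⟨(h a).1, (h a).2.1.trans_le hp, (h a).2.2.trans_le hq⟩⟩

lemma HasIncreasing.le_chainLen {T : ℕ → ℕ → Prop} {k p q : ℕ} (h : HasIncreasing T k p q) :
    k ≤ chainLen T p q := by
  induction k generalizing p q with
  | zero => omega
  | succ k ih =>
    obtain ⟨r, c, hr, hc, h⟩ := h
    obtain ⟨h1, h2, h3⟩ := h (Fin.last k)
    have h4 : k ≤ chainLen T (r (Fin.last k)) (c (Fin.last k)) :=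
      ih ⟨fun a => r a.castSucc, fun a => c a.castSucc,
        hr.comp (Fin.strictMono_castSucc), hc.comp (Fin.strictMono_castSucc), fun a =>
        ⟨(h _).1, hr (Fin.castSucc_lt_last a), hc (Fin.castSucc_lt_last a)⟩⟩
    have h5 := chainLen_succ_of_mem h1
    have h6 := chainLen_mono_left (T := T) (r (Fin.last k)) (c (Fin.last k))
    have h7 : chainLen T (r (Fin.last k) + 1) (c (Fin.last k) + 1) ≤ chainLen T p q :=
      chainLen_mono h2 h3
    omega

lemma hasIncreasing_of_le_chainLen {T : ℕ → ℕ → Prop} (hT : IsPartialPerm T) (p q : ℕ) {k : ℕ}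
    (h : k ≤ chainLen T p q) : HasIncreasing T k p q := by
  induction p generalizing k q with
  | zero =>
    obtain rfl : k = 0 := by simpa using h
    exact ⟨Fin.elim0, Fin.elim0, fun a => a.elim0, fun a => a.elim0, fun a => a.elim0⟩
  | succ p ihp =>
    induction q generalizing k with
    | zero =>
      obtain rfl : k = 0 := by simpa using h
      exact ⟨Fin.elim0, Fin.elim0, fun a => a.elim0, fun a => a.elim0, fun a => a.elim0⟩
    | succ q ihq =>
      by_cases hm : T p q
      · rw [chainLen_succ_of_mem hm, chainLen_eq_left hT hm, chainLen_eq_right hT hm] at h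
        cases k with
        | zero =>
          exact ⟨Fin.elim0, Fin.elim0, fun a => a.elim0, fun a => a.elim0, fun a => a.elim0⟩
        | succ k =>
          obtain ⟨r, c, hr, hc, h⟩ := ihp (k := k) q (by omega)
          refine ⟨Fin.snoc r p, Fin.snoc c q, strictMono_snoc hr fun a => (h a).2.1,
            strictMono_snoc hc fun a => (h a).2.2, fun a => ?_⟩
          induction a using Fin.lastCases with
          | last => simpa using hm
          | cast a =>
            have := h a
            simp only [Fin.snoc_castSucc]
            exact ⟨this.1, by omega, by omega⟩
      · rw [chainLen_succ_of_not_mem hm] at h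
        rcases le_max_iff.1 h with h | h
        · exact (ihq h).mono le_rfl (by omega)
        · exact (ihp _ h).mono (by omega) le_rfl

lemma HasDecreasing.skeleton {T : ℕ → ℕ → Prop} {k p q : ℕ}
    (h : HasDecreasing T (k + 1) p q) : HasDecreasing (skeleton T) k p q := by
  obtain ⟨r, c, hr, hc, h⟩ := h
  have key : ∀ a : Fin k, ∃ x : ℕ × ℕ, _root_.skeleton T x.1 x.2 ∧ r a.castSucc < x.1 ∧
      x.1 ≤ r a.succ ∧ c a.succ < x.2 ∧ x.2 ≤ c a.castSucc := fun a => by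
    obtain ⟨s, y, h⟩ := exists_skeleton_of_decreasing (h a.castSucc).1 (h a.succ).1
      (hr Fin.castSucc_lt_succ) (hc Fin.castSucc_lt_succ)
    exact ⟨(s, y), h⟩
  choose x hx using key
  refine ⟨fun a => (x a).1, fun a => (x a).2, fun a b hab => ?_, fun a b hab => ?_, fun a => ?_⟩
  · have h1 := hr.monotone (show a.succ ≤ b.castSucc from hab)
    exact ((hx a).2.2.1.trans h1).trans_lt (hx b).2.1
  · have h1 := hc.antitone (show a.succ ≤ b.castSucc from hab)
    exact ((hx b).2.2.2.2.trans h1).trans_lt (hx a).2.2.2.1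
  · exact ⟨(hx a).1, (hx a).2.2.1.trans_lt (h _).2.1, (hx a).2.2.2.2.trans_lt (h _).2.2⟩

lemma HasDecreasing.of_skeleton {T : ℕ → ℕ → Prop} (hT : IsPartialPerm T) {k p q : ℕ}
    (h : HasDecreasing (_root_.skeleton T) (k + 1) p q) : HasDecreasing T (k + 2) p q := by
  obtain ⟨r, c, hr, hc, h⟩ := h
  have key : ∀ a : Fin (k + 2), ∃ x : ℕ × ℕ, (T x.1 x.2 ∧ x.1 < p ∧ x.2 < q) ∧
      (∀ b : Fin (k + 1), b.castSucc < a → r b ≤ x.1 ∧ x.2 < c b) ∧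
      ∀ b : Fin (k + 1), a ≤ b.castSucc → x.1 < r b ∧ c b ≤ x.2 := fun a => by
    induction a using Fin.cases with
    | zero =>
      obtain ⟨x, h1, h2⟩ := (h 0).1.exists_mem_left
      refine ⟨(x, c 0), ⟨h2, h1.trans (h 0).2.1, (h 0).2.2⟩, fun b hb => ?_, fun b hb => ?_⟩
      · exact absurd hb (by simp)
      · exact ⟨h1.trans_le (hr.monotone (Fin.zero_le b)), hc.antitone (Fin.zero_le b)⟩
    | succ a =>
      induction a using Fin.lastCases with
      | last =>
        obtain ⟨y, h1, h2⟩ := (h (Fin.last k)).1.exists_mem_below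
        refine ⟨(r (Fin.last k), y), ⟨h2, (h _).2.1, h1.trans (h _).2.2⟩, fun b hb => ?_,
          fun b hb => ?_⟩
        · exact ⟨hr.monotone (Fin.le_last b), h1.trans_le (hc.antitone (Fin.le_last b))⟩
        · rw [Fin.le_def] at hb
          have := b.2
          simp at hb
          omega
      | cast a =>
        obtain ⟨x, y, h1, h2, h3, h4, h5⟩ := exists_mem_of_skeleton hT (h a.castSucc).1
          (h a.succ).1 (hr Fin.castSucc_lt_succ) (hc Fin.castSucc_lt_succ)
        refine ⟨(x, y), ⟨h1, h3.trans (h _).2.1, h5.trans (h _).2.2⟩, fun b hb => ?_,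
          fun b hb => ?_⟩
        · have hb' : b ≤ a.castSucc := by
            rw [Fin.lt_def] at hb
            rw [Fin.le_def]
            simp at hb ⊢
            omega
          exact ⟨(hr.monotone hb').trans h2, h5.trans_le (hc.antitone hb')⟩
        · have hb' : a.succ ≤ b := by
            rw [Fin.le_def] at hb ⊢
            simpa using hb
          exact ⟨h3.trans_le (hr.monotone hb'), (hc.antitone hb').trans h4⟩
  choose x hx using key
  refine ⟨fun a => (x a).1, fun a => (x a).2, fun a b hab => ?_, fun a b hab => ?_,
    fun a => (hx a).1⟩
  all_goals
    have h1 := (hx a).2.2 (a.castLT (by omega)) (by simp)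
    have h2 := (hx b).2.1 (a.castLT (by omega)) (by simpa using hab)
    simp only
    omega

/-- The label of the vertex `(i, j)` in the growth diagram of `T`. -/
noncomputable def growth (T : ℕ → ℕ → Prop) (i j r : ℕ) : ℕ := chainLen (skeleton^[r] T) i j

lemma growth_succ (T : ℕ → ℕ → Prop) (i j r : ℕ) :
    growth T i j (r + 1) = growth (skeleton T) i j r := rfl

lemma IsPartialPerm.iterate_skeleton {T : ℕ → ℕ → Prop} (hT : IsPartialPerm T) (r : ℕ) :
    IsPartialPerm (_root_.skeleton^[r] T) := by
  induction r generalizing T with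
  | zero => exact hT
  | succ r ih => exact ih hT.skeleton

lemma hasIncreasing_iff {T : ℕ → ℕ → Prop} (hT : IsPartialPerm T) {k p q : ℕ} :
    HasIncreasing T k p q ↔ k ≤ growth T p q 0 :=
  ⟨fun h => h.le_chainLen, hasIncreasing_of_le_chainLen hT p q⟩

lemma hasDecreasing_iff {T : ℕ → ℕ → Prop} (hT : IsPartialPerm T) {k p q : ℕ} :
    HasDecreasing T (k + 1) p q ↔ 0 < growth T p q k := by
  induction k generalizing T with
  | zero =>
    rw [← Nat.succ_le_iff, ← hasIncreasing_iff hT]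
    have hsub : ∀ (f : Fin 1 → ℕ), StrictMono f ∧ StrictAnti f := fun f =>
      ⟨Subsingleton.strictMono f, Subsingleton.strictAnti f⟩
    exact ⟨fun ⟨r, c, h1, h2, h⟩ => ⟨r, c, h1, (hsub c).1, h⟩,
      fun ⟨r, c, h1, h2, h⟩ => ⟨r, c, h1, (hsub c).2, h⟩⟩
  | succ k ih =>
    rw [growth_succ, ← ih hT.skeleton]
    exact ⟨HasDecreasing.skeleton, HasDecreasing.of_skeleton hT⟩

lemma growthRule_row_iff {T : ℕ → ℕ → Prop} {G : ℕ → ℕ → ℕ → ℕ} {i : ℕ} (h0 : G (i + 1) 0 = G i 0)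
    {j : ℕ} (h : ∀ j' < j, GrowthRule (G i j') (G (i + 1) j') (G i (j' + 1)) (G (i + 1) (j' + 1))
      (T i j')) : G (i + 1) j = G i j ↔ ∀ j' < j, ¬ T i j' := by
  induction j with
  | zero => simpa using h0
  | succ j ih =>
    rw [(h j (by omega)).eq_right_iff, ih fun j' hj' => h j' (by omega)]
    refine ⟨fun h1 j' hj' => ?_, fun h1 => ⟨fun j' hj' => h1 j' (by omega), h1 j (by omega)⟩⟩
    rcases Nat.lt_succ_iff_lt_or_eq.1 hj' with h2 | rfl
    exacts [h1.1 j' h2, h1.2]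

lemma growthRule_column_iff {T : ℕ → ℕ → Prop} {G : ℕ → ℕ → ℕ → ℕ} {j : ℕ}
    (h0 : G 0 (j + 1) = G 0 j) {i : ℕ} (h : ∀ i' < i, GrowthRule (G i' j) (G (i' + 1) j)
      (G i' (j + 1)) (G (i' + 1) (j + 1)) (T i' j)) :
    G i (j + 1) = G i j ↔ ∀ i' < i, ¬ T i' j :=
  growthRule_row_iff (T := Function.swap T) (G := Function.swap G) h0 fun i' hi' => (h i' hi').symm

lemma chainLen_skeleton_succ {T : ℕ → ℕ → Prop} (hT : IsPartialPerm T) (i j : ℕ) :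
    chainLen (skeleton T) (i + 1) (j + 1) + chainLen T i j =
      max (chainLen (skeleton T) (i + 1) j) (chainLen (skeleton T) i (j + 1)) +
        min (chainLen T (i + 1) j) (chainLen T i (j + 1)) := by
  have h1 := chainLen_step_left hT i j
  have h2 := chainLen_step_right hT i j
  have h3 := chainLen_mono_left (T := T) i j
  have h4 := chainLen_mono_right (T := T) i j
  by_cases h : skeleton T i j
  · have h5 := chainLen_succ_of_mem h
    obtain ⟨h6, h7⟩ := h
    omega
  · have h5 := chainLen_succ_of_not_mem h
    rw [skeleton] at h
    omega

@[simp] lemma growth_zero_left (T : ℕ → ℕ → Prop) (j : ℕ) : growth T 0 j = 0 := by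
  funext r; simp [growth]

@[simp] lemma growth_zero_right (T : ℕ → ℕ → Prop) (i : ℕ) : growth T i 0 = 0 := by
  funext r; simp [growth]

lemma growth_growthRule {T : ℕ → ℕ → Prop} (hT : IsPartialPerm T) (i j : ℕ) :
    GrowthRule (growth T i j) (growth T (i + 1) j) (growth T i (j + 1))
      (growth T (i + 1) (j + 1)) (T i j) := by
  induction hn : i + j using Nat.strong_induction_on generalizing i j with
  | _ n ih =>
    subst hn
    refine ⟨?_, ?_, fun h => ⟨?_, ?_⟩, fun h => ?_, fun h => ?_, fun r => ?_⟩
    · cases j with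
      | zero => exact Or.inl (by simp)
      | succ j => exact (ih (i + j) (by omega) i j rfl).addsBox_right
    · cases i with
      | zero => exact Or.inl (by simp)
      | succ i => exact (ih (i + j) (by omega) i j rfl).symm.addsBox_right
    · exact (growthRule_row_iff (T := T) (by simp)
        fun j' hj' => ih (i + j') (by omega) i j' rfl).2 fun j' hj' h' => hj'.ne (hT.row h' h)
    · exact (growthRule_column_iff (T := T) (by simp)
        fun i' hi' => ih (i' + j) (by omega) i' j rfl).2 fun i' hi' h' => hi'.ne (hT.col h' h)
    · exact chainLen_succ_of_not_mem h
    · exact chainLen_succ_of_mem h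
    · simp only [growth, Function.iterate_succ_apply']
      exact chainLen_skeleton_succ (hT.iterate_skeleton r) i j

lemma growth_isPartition {T : ℕ → ℕ → Prop} (hT : IsPartialPerm T) (i j : ℕ) :
    IsPartition (growth T i j) := by
  induction i generalizing j with
  | zero => simpa using isPartition_zero
  | succ i ihi =>
    induction j with
    | zero => simpa using isPartition_zero
    | succ j ihj => exact (growth_growthRule hT i j).isPartition (ihi j) ihj (ihi (j + 1))

/-- `T` is a partial permutation supported on the shape `Y`. -/
structure IsFilling (Y : Finset (ℕ × ℕ)) (T : ℕ → ℕ → Prop) : Prop where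
  isPartialPerm : IsPartialPerm T
  mem : ∀ {i j}, T i j → (i, j) ∈ Y

/-- The vertex `(i, j)` belongs to the closed region covered by the cells of `Y`. -/
def IsVertex (Y : Finset (ℕ × ℕ)) (i j : ℕ) : Prop :=
  ∀ i' j', i = i' + 1 → j = j' + 1 → (i', j') ∈ Y

section shapes

variable {Y : Finset (ℕ × ℕ)}

lemma mem_of_le (hY : IsLowerSet (Y : Set (ℕ × ℕ))) {i i' j j' : ℕ} (h : (i', j') ∈ Y)
    (hi : i ≤ i') (hj : j ≤ j') : (i, j) ∈ Y :=
  Finset.mem_coe.1 (hY (show (i, j) ≤ (i', j') from ⟨hi, hj⟩) h)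

lemma isVertex_of_mem (hY : IsLowerSet (Y : Set (ℕ × ℕ))) {i j : ℕ} (h : (i, j) ∈ Y) :
    IsVertex Y i j ∧ IsVertex Y (i + 1) j ∧ IsVertex Y i (j + 1) ∧ IsVertex Y (i + 1) (j + 1) := by
  refine ⟨?_, ?_, ?_, ?_⟩ <;> exact fun i' j' h1 h2 => mem_of_le hY h (by omega) (by omega)

lemma exists_bound (Y : Finset (ℕ × ℕ)) : ∃ N, ∀ i j, (i, j) ∈ Y → i + j < N := by
  refine ⟨Y.sup (fun x => x.1 + x.2) + 1, fun i j h => ?_⟩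
  have := Finset.le_sup (f := fun x : ℕ × ℕ => x.1 + x.2) h
  simp only at this
  omega

/-- Every boundary labelling of a shape comes from a growth diagram. -/
lemma exists_growth_of_boundary (Y : Finset (ℕ × ℕ)) (hY : IsLowerSet (Y : Set (ℕ × ℕ)))
    (G : ℕ → ℕ → ℕ → ℕ) (hG : ∀ i j, IsPartition (G i j))
    (h1 : ∀ i j, (i, j) ∉ Y → AddsBox (G i j) (G (i + 1) j))
    (h2 : ∀ i j, (i, j) ∉ Y → AddsBox (G i j) (G i (j + 1)))
    (h3 : ∀ j, G 0 j = 0) (h4 : ∀ i, G i 0 = 0) :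
    ∃ (T : ℕ → ℕ → Prop) (H : ℕ → ℕ → ℕ → ℕ), (∀ i j, T i j → (i, j) ∈ Y) ∧
      (∀ i j, (i, j) ∉ Y → H i j = G i j) ∧ (∀ j, H 0 j = 0) ∧ (∀ i, H i 0 = 0) ∧
      ∀ i j, (i, j) ∈ Y →
        GrowthRule (H i j) (H (i + 1) j) (H i (j + 1)) (H (i + 1) (j + 1)) (T i j) := by
  induction hn : Y.card generalizing Y G with
  | zero =>
    obtain rfl := Finset.card_eq_zero.1 hn
    exact ⟨fun _ _ => False, G, by simp, by simp, h3, h4, by simp⟩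
  | succ n ih =>
    obtain ⟨x, hx⟩ := Y.exists_maximal (Finset.card_pos.1 (by omega))
    obtain ⟨a, b⟩ := x
    have hmax : ∀ i j, a ≤ i → b ≤ j → (i, j) ∈ Y → i = a ∧ j = b := fun i j hi hj h => by
      have := hx.eq_of_le h (show (a, b) ≤ (i, j) from ⟨hi, hj⟩)
      simp only [Prod.mk.injEq] at this
      exact ⟨this.1.symm, this.2.symm⟩
    have n1 : (a + 1, b) ∉ Y := fun h => by have := hmax _ _ (by omega) le_rfl h; omega
    have n2 : (a, b + 1) ∉ Y := fun h => by have := hmax _ _ le_rfl (by omega) h; omega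
    have n3 : (a + 1, b + 1) ∉ Y := fun h => by
      have := hmax _ _ (by omega) (by omega) h; omega
    obtain ⟨ρ, X, hρ, hrule⟩ := exists_growthRule (hG (a + 1) b) (hG a (b + 1))
      (hG (a + 1) (b + 1)) (h2 _ _ n1) (h1 _ _ n2)
    set G' : ℕ → ℕ → ℕ → ℕ := fun i j => if i = a ∧ j = b then ρ else G i j with hG'
    have e0 : G' a b = ρ := by simp [hG']
    have e1 : ∀ i j, ¬ (i = a ∧ j = b) → G' i j = G i j := fun i j h => if_neg h
    have hmem : ∀ i j, (i, j) ∈ Y.erase (a, b) ↔ ¬ (i = a ∧ j = b) ∧ (i, j) ∈ Y := fun i j => by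
      simp [Finset.mem_erase, Prod.ext_iff]
    have hedge : ∀ i j i' j', i ≤ i' → j ≤ j' → (i, j) ∉ Y → AddsBox (G i j) (G i' j') →
        AddsBox (G' i j) (G' i' j') := fun i j i' j' hi hj h hadd => by
      rw [e1, e1]
      · exact hadd
      · rintro ⟨rfl, rfl⟩; exact h (mem_of_le hY hx.1 hi hj)
      · rintro ⟨rfl, rfl⟩; exact h hx.1
    have hind := ih (Y.erase (a, b)) ?_ G' ?_ ?_ ?_ ?_ ?_ ?_
    · obtain ⟨T, H, t1, t2, t3, t4, t5⟩ := hind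
      have s : ∀ i j, (i, j) ∉ Y.erase (a, b) → ¬ T i j := fun i j h h' => h (t1 i j h')
      refine ⟨fun i j => T i j ∨ (i = a ∧ j = b ∧ X), H, fun i j h => ?_, fun i j h => ?_, t3, t4,
        fun i j h => ?_⟩
      · rcases h with h | ⟨rfl, rfl, -⟩
        · exact ((hmem i j).1 (t1 i j h)).2
        · exact hx.1
      · rw [t2 i j fun h' => h ((hmem i j).1 h').2, e1]
        rintro ⟨rfl, rfl⟩
        exact h hx.1
      · by_cases hij : i = a ∧ j = b
        · obtain ⟨rfl, rfl⟩ := hij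
          have hT : (T i j ∨ (i = i ∧ j = j ∧ X)) = X := by
            have := s i j (by simp)
            simp [this]
          beta_reduce
          rw [hT, t2 i j (by simp), t2 (i + 1) j (fun h' => n1 ((hmem _ _).1 h').2),
            t2 i (j + 1) (fun h' => n2 ((hmem _ _).1 h').2),
            t2 (i + 1) (j + 1) (fun h' => n3 ((hmem _ _).1 h').2), e0, e1 _ _ (by omega),
            e1 _ _ (by omega), e1 _ _ (by omega)]
          exact hrule
        · have hT : (T i j ∨ (i = a ∧ j = b ∧ X)) = T i j := by
            simp only [eq_iff_iff, or_iff_left_iff_imp]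
            exact fun h' => absurd ⟨h'.1, h'.2.1⟩ hij
          beta_reduce
          rw [hT]
          exact t5 i j ((hmem i j).2 ⟨hij, h⟩)
    · intro x y hxy hxm
      obtain ⟨i, j⟩ := x
      obtain ⟨i', j'⟩ := y
      have h5 := (hmem i j).1 hxm
      refine (hmem i' j').2 ⟨?_, mem_of_le hY h5.2 hxy.1 hxy.2⟩
      rintro ⟨rfl, rfl⟩
      exact h5.1 (hmax i j hxy.1 hxy.2 h5.2)
    · intro i j
      by_cases hij : i = a ∧ j = b
      · rw [hij.1, hij.2, e0]; exact hρ
      · rw [e1 i j hij]; exact hG i j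
    · intro i j h
      by_cases hij : i = a ∧ j = b
      · rw [hij.1, hij.2, e0, e1 _ _ (by omega)]; exact hrule.left
      · have h' : (i, j) ∉ Y := fun h' => h ((hmem i j).2 ⟨hij, h'⟩)
        exact hedge _ _ _ _ (by omega) le_rfl h' (h1 i j h')
    · intro i j h
      by_cases hij : i = a ∧ j = b
      · rw [hij.1, hij.2, e0, e1 _ _ (by omega)]; exact hrule.right
      · have h' : (i, j) ∉ Y := fun h' => h ((hmem i j).2 ⟨hij, h'⟩)
        exact hedge _ _ _ _ le_rfl (by omega) h' (h2 i j h')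
    · intro j
      by_cases hij : 0 = a ∧ j = b
      · rw [hij.1, hij.2, e0]
        funext r
        have := hrule.right.le r
        rw [← hij.1, h3] at this
        simpa using this.1
      · rw [e1 0 j hij, h3]
    · intro i
      by_cases hij : i = a ∧ 0 = b
      · rw [hij.1, hij.2, e0]
        funext r
        have := hrule.left.le r
        rw [← hij.2, h4] at this
        simpa using this.1
      · rw [e1 i 0 hij, h4]
    · rw [Finset.card_erase_of_mem hx.1, hn]; rfl

/-- A growth diagram is determined by the marked cells. -/
lemma eq_growth (hY : IsLowerSet (Y : Set (ℕ × ℕ))) {T : ℕ → ℕ → Prop} (hT : IsPartialPerm T)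
    {H : ℕ → ℕ → ℕ → ℕ} (h3 : ∀ j, H 0 j = 0) (h4 : ∀ i, H i 0 = 0)
    (h5 : ∀ i j, (i, j) ∈ Y →
      GrowthRule (H i j) (H (i + 1) j) (H i (j + 1)) (H (i + 1) (j + 1)) (T i j)) (i j : ℕ)
    (hv : IsVertex Y i j) : H i j = growth T i j := by
  induction i generalizing j with
  | zero => rw [h3, growth_zero_left]
  | succ i ihi =>
    induction j with
    | zero => rw [h4, growth_zero_right]
    | succ j ihj =>
      have hm := hv i j rfl rfl
      obtain ⟨v1, v2, v3, -⟩ := isVertex_of_mem hY hm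
      have := h5 i j hm
      rw [ihi j v1, ihj v2, ihi (j + 1) v3] at this
      exact this.unique_top (growth_growthRule hT i j)

/-- A filling of a shape is determined by the labels of its growth diagram on the boundary. -/
lemma filling_unique (hY : IsLowerSet (Y : Set (ℕ × ℕ))) {T T' : ℕ → ℕ → Prop}
    (hT : IsFilling Y T) (hT' : IsFilling Y T')
    (h : ∀ i j, (i, j) ∉ Y → IsVertex Y i j → growth T i j = growth T' i j) : T = T' := by
  obtain ⟨N, hN⟩ := exists_bound Y
  have key : ∀ s i j, N ≤ i + j + s → IsVertex Y i j → growth T i j = growth T' i j := by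
    intro s
    induction s with
    | zero => exact fun i j hs hv => h i j (fun hm => by have := hN i j hm; omega) hv
    | succ s ih =>
      intro i j hs hv
      by_cases hm : (i, j) ∈ Y
      · obtain ⟨-, v1, v2, v3⟩ := isVertex_of_mem hY hm
        have g := growth_growthRule hT.isPartialPerm i j
        rw [ih (i + 1) j (by omega) v1, ih i (j + 1) (by omega) v2,
          ih (i + 1) (j + 1) (by omega) v3] at g
        exact (g.unique_bottom (growth_growthRule hT'.isPartialPerm i j)).1
      · exact h i j hm hv
  funext i j
  by_cases hm : (i, j) ∈ Y
  · obtain ⟨-, v1, v2, v3⟩ := isVertex_of_mem hY hm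
    have g := growth_growthRule hT.isPartialPerm i j
    rw [key N (i + 1) j (by omega) v1, key N i (j + 1) (by omega) v2,
      key N (i + 1) (j + 1) (by omega) v3] at g
    exact propext (g.unique_bottom (growth_growthRule hT'.isPartialPerm i j)).2
  · exact propext ⟨fun h => absurd (hT.mem h) hm, fun h => absurd (hT'.mem h) hm⟩

/-- The boundary labels of the growth diagrams of `T` and `T'` on `Y` are conjugate. -/
def AreConjugate (Y : Finset (ℕ × ℕ)) (T T' : ℕ → ℕ → Prop) : Prop :=
  ∀ i j, (i, j) ∉ Y → IsVertex Y i j → growth T' i j = conjugate (growth T i j)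

lemma AreConjugate.symm {T T' : ℕ → ℕ → Prop} (hT : IsFilling Y T) (h : AreConjugate Y T T') :
    AreConjugate Y T' T := fun i j hm hv => by
  rw [h i j hm hv, conjugate_conjugate (growth_isPartition hT.isPartialPerm i j)]

lemma exists_areConjugate (hY : IsLowerSet (Y : Set (ℕ × ℕ))) {T : ℕ → ℕ → Prop}
    (hT : IsFilling Y T) : ∃ T', IsFilling Y T' ∧ AreConjugate Y T T' := by
  have hP := growth_isPartition hT.isPartialPerm
  have hR := growth_growthRule hT.isPartialPerm
  obtain ⟨T', H, t1, t2, t3, t4, t5⟩ := exists_growth_of_boundary Y hY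
    (fun i j => conjugate (growth T i j)) (fun i j => conjugate_isPartition (hP i j))
    (fun i j _ => addsBox_conjugate (hR i j).left (hP _ _) (hP _ _))
    (fun i j _ => addsBox_conjugate (hR i j).right (hP _ _) (hP _ _))
    (fun j => by rw [growth_zero_left, conjugate_zero])
    (fun i => by rw [growth_zero_right, conjugate_zero])
  have hperm : IsPartialPerm T' := by
    constructor
    · intro i j j' h h'
      wlog hj : j < j' generalizing j j'
      · by_contra hne
        exact hne (this h' h (by omega)).symm
      refine absurd h ((growthRule_row_iff (T := T') (G := H) (i := i) (j := j')
        (by rw [t4, t4]) fun b hb => t5 i b ?_).1 ((t5 i j' (t1 i j' h')).marked h').1 j hj)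
      exact mem_of_le hY (t1 i j' h') le_rfl hb.le
    · intro i i' j h h'
      wlog hi : i < i' generalizing i i'
      · by_contra hne
        exact hne (this h' h (by omega)).symm
      refine absurd h ((growthRule_column_iff (T := T') (G := H) (j := j) (i := i')
        (by rw [t3, t3]) fun b hb => t5 b j ?_).1 ((t5 i' j (t1 i' j h')).marked h').2 i hi)
      exact mem_of_le hY (t1 i' j h') hb.le le_rfl
  refine ⟨T', ⟨hperm, fun h => t1 _ _ h⟩, fun i j hm hv => ?_⟩
  rw [← eq_growth hY hperm t3 t4 t5 i j hv, t2 i j hm]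

lemma AreConjugate.row_iff (hY : IsLowerSet (Y : Set (ℕ × ℕ))) {T T' : ℕ → ℕ → Prop}
    (hT : IsFilling Y T) (hT' : IsFilling Y T') (h : AreConjugate Y T T') (i : ℕ) :
    (∃ j, T' i j) ↔ ∃ j, T i j := by
  obtain ⟨N, hN⟩ := exists_bound Y
  have hex : ∃ J, (i, J) ∉ Y := ⟨N, fun hm => by have := hN _ _ hm; omega⟩
  classical
  obtain ⟨J, hJ, hlt⟩ : ∃ J, (i, J) ∉ Y ∧ ∀ j < J, (i, j) ∈ Y :=
    ⟨Nat.find hex, Nat.find_spec hex, fun j hj => not_not.1 (Nat.find_min hex hj)⟩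
  have v1 : IsVertex Y i J := fun i' j' h1 h2 =>
    mem_of_le hY (hlt j' (by omega)) (by omega) le_rfl
  have v2 : IsVertex Y (i + 1) J := fun i' j' h1 h2 =>
    mem_of_le hY (hlt j' (by omega)) (by omega) le_rfl
  have hJ' : (i + 1, J) ∉ Y := fun hm => hJ (mem_of_le hY hm (by omega) le_rfl)
  have key : ∀ S, IsFilling Y S → ((∃ j, S i j) ↔ growth S (i + 1) J ≠ growth S i J) :=
      fun S hS => by
    rw [ne_eq, growthRule_row_iff (T := S) (by simp)
      fun j' _ => growth_growthRule hS.isPartialPerm i j']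
    push Not
    refine ⟨fun ⟨j, hj⟩ => ⟨j, ?_, hj⟩, fun ⟨j, _, hj⟩ => ⟨j, hj⟩⟩
    by_contra hle
    exact hJ (mem_of_le hY (hS.mem hj) le_rfl (not_lt.1 hle))
  rw [key T hT, key T' hT', h _ _ hJ v1, h _ _ hJ' v2, ne_eq, ne_eq,
    conjugate_injective (growth_isPartition hT.isPartialPerm _ _)
      (growth_isPartition hT.isPartialPerm _ _)]

lemma AreConjugate.column_iff (hY : IsLowerSet (Y : Set (ℕ × ℕ))) {T T' : ℕ → ℕ → Prop}
    (hT : IsFilling Y T) (hT' : IsFilling Y T') (h : AreConjugate Y T T') (j : ℕ) :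
    (∃ i, T' i j) ↔ ∃ i, T i j := by
  obtain ⟨N, hN⟩ := exists_bound Y
  have hex : ∃ J, (J, j) ∉ Y := ⟨N, fun hm => by have := hN _ _ hm; omega⟩
  classical
  obtain ⟨J, hJ, hlt⟩ : ∃ J, (J, j) ∉ Y ∧ ∀ i < J, (i, j) ∈ Y :=
    ⟨Nat.find hex, Nat.find_spec hex, fun j hj => not_not.1 (Nat.find_min hex hj)⟩
  have v1 : IsVertex Y J j := fun i' j' h1 h2 =>
    mem_of_le hY (hlt i' (by omega)) le_rfl (by omega)
  have v2 : IsVertex Y J (j + 1) := fun i' j' h1 h2 =>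
    mem_of_le hY (hlt i' (by omega)) le_rfl (by omega)
  have hJ' : (J, j + 1) ∉ Y := fun hm => hJ (mem_of_le hY hm le_rfl (by omega))
  have key : ∀ S, IsFilling Y S → ((∃ i, S i j) ↔ growth S J (j + 1) ≠ growth S J j) :=
      fun S hS => by
    rw [ne_eq, growthRule_column_iff (T := S) (by simp)
      fun i' _ => growth_growthRule hS.isPartialPerm i' j]
    push Not
    refine ⟨fun ⟨i, hi⟩ => ⟨i, ?_, hi⟩, fun ⟨i, _, hi⟩ => ⟨i, hi⟩⟩
    by_contra hle
    exact hJ (mem_of_le hY (hS.mem hi) (not_lt.1 hle) le_rfl)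
  rw [key T hT, key T' hT', h _ _ hJ v1, h _ _ hJ' v2, ne_eq, ne_eq,
    conjugate_injective (growth_isPartition hT.isPartialPerm _ _)
      (growth_isPartition hT.isPartialPerm _ _)]

lemma exists_boundary_cell (hY : IsLowerSet (Y : Set (ℕ × ℕ))) {p q : ℕ} (h : (p, q) ∈ Y) :
    ∃ p' q', p ≤ p' ∧ q ≤ q' ∧ (p', q') ∈ Y ∧ (p' + 1, q' + 1) ∉ Y := by
  obtain ⟨N, hN⟩ := exists_bound Y
  have hex : ∃ s, (p + s + 1, q + s + 1) ∉ Y := ⟨N, fun hm => by have := hN _ _ hm; omega⟩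
  classical
  refine ⟨p + Nat.find hex, q + Nat.find hex, by omega, by omega, ?_, Nat.find_spec hex⟩
  rcases Nat.eq_zero_or_pos (Nat.find hex) with h0 | h0
  · rw [h0]; exact h
  · have := not_not.1 (Nat.find_min hex (Nat.sub_one_lt h0.ne'))
    exact mem_of_le hY this (by omega) (by omega)

lemma AreConjugate.hasIncreasing_iff (hY : IsLowerSet (Y : Set (ℕ × ℕ))) {T T' : ℕ → ℕ → Prop}
    (hT : IsFilling Y T) (hT' : IsFilling Y T') (h : AreConjugate Y T T') (k : ℕ) :
    (∃ p q, (p, q) ∈ Y ∧ HasIncreasing T (k + 1) (p + 1) (q + 1)) ↔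
      ∃ p q, (p, q) ∈ Y ∧ HasDecreasing T' (k + 1) (p + 1) (q + 1) := by
  have key : ∀ p q, (p, q) ∈ Y → (p + 1, q + 1) ∉ Y →
      (HasIncreasing T (k + 1) (p + 1) (q + 1) ↔ HasDecreasing T' (k + 1) (p + 1) (q + 1)) :=
      fun p q hm hn => by
    rw [_root_.hasIncreasing_iff hT.isPartialPerm, hasDecreasing_iff hT'.isPartialPerm,
      h _ _ hn (isVertex_of_mem hY hm).2.2.2,
      lt_conjugate_iff (growth_isPartition hT.isPartialPerm _ _), Nat.succ_le_iff]
  constructor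
  · rintro ⟨p, q, hm, hc⟩
    obtain ⟨p', q', hp, hq, hm', hn⟩ := exists_boundary_cell hY hm
    exact ⟨p', q', hm', (key p' q' hm' hn).1 (hc.mono (by omega) (by omega))⟩
  · rintro ⟨p, q, hm, hc⟩
    obtain ⟨p', q', hp, hq, hm', hn⟩ := exists_boundary_cell hY hm
    exact ⟨p', q', hm', (key p' q' hm' hn).2 (hc.mono (by omega) (by omega))⟩

/-- Conjugating boundary labels is an involution on the fillings of a shape that keeps the
occupied rows and columns and turns increasing chains into decreasing ones. -/
theorem exists_filling_involution (hY : IsLowerSet (Y : Set (ℕ × ℕ))) :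
    ∃ Φ : (ℕ → ℕ → Prop) → ℕ → ℕ → Prop, ∀ T, IsFilling Y T →
      IsFilling Y (Φ T) ∧ Φ (Φ T) = T ∧ (∀ i, (∃ j, Φ T i j) ↔ ∃ j, T i j) ∧
      (∀ j, (∃ i, Φ T i j) ↔ ∃ i, T i j) ∧
      ∀ k, (∃ p q, (p, q) ∈ Y ∧ HasIncreasing T (k + 1) (p + 1) (q + 1)) ↔
        ∃ p q, (p, q) ∈ Y ∧ HasDecreasing (Φ T) (k + 1) (p + 1) (q + 1) := by
  classical
  choose! Φ hΦ hc using fun T (hT : IsFilling Y T) => exists_areConjugate hY hT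
  refine ⟨Φ, fun T hT => ⟨hΦ T hT, ?_, (hc T hT).row_iff hY hT (hΦ T hT),
    (hc T hT).column_iff hY hT (hΦ T hT), (hc T hT).hasIncreasing_iff hY hT (hΦ T hT)⟩⟩
  refine filling_unique hY (hΦ _ (hΦ T hT)) hT fun i j hm hv => ?_
  rw [hc _ (hΦ T hT) i j hm hv, (hc T hT).symm hT i j hm hv]

end shapes

/-- Transport of a set of cells of an `n × n` matrix to `ℕ × ℕ`, reversing the columns. -/
def reflectCells {n : ℕ} (T : Fin n → Fin n → Prop) (p q : ℕ) : Prop :=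
  ∃ i j : Fin n, T i j ∧ p = i ∧ q = j.rev

lemma reflectCells_coe_rev {n : ℕ} {T : Fin n → Fin n → Prop} {i j : Fin n} :
    reflectCells T i j.rev ↔ T i j := by
  refine ⟨?_, fun h => ⟨i, j, h, rfl, rfl⟩⟩
  rintro ⟨i', j', h, h1, h2⟩
  rwa [Fin.ext h1, Fin.rev_injective (Fin.ext h2)]

lemma reflectCells_unreflect {n : ℕ} {S : ℕ → ℕ → Prop} {Y : Fin n → Fin n → Prop}
    (h : ∀ p q, S p q → reflectCells Y p q) :
    reflectCells (fun i j : Fin n => S i j.rev) = S := by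
  funext p q
  refine propext ⟨?_, fun hS => ?_⟩
  · rintro ⟨i, j, hij, rfl, rfl⟩
    exact hij
  · obtain ⟨i, j, -, rfl, rfl⟩ := h p q hS
    exact ⟨i, j, hS, rfl, rfl⟩

lemma exists_hasIncreasing_reflectCells_iff {n k : ℕ} {Y T : Fin n → Fin n → Prop}
    (hY : ∀ i j i' j', Y i j → i' ≤ i → j ≤ j' → Y i' j') :
    (∃ p q, reflectCells Y p q ∧ HasIncreasing (reflectCells T) (k + 1) (p + 1) (q + 1)) ↔
      ∃ R C : Fin (k + 1) → Fin n, StrictMono R ∧ StrictMono C ∧ (∀ a b, Y (R a) (C b)) ∧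
        ∀ a, T (R a) (C a.rev) := by
  constructor
  · rintro ⟨p, q, ⟨i, j, hij, rfl, rfl⟩, r, c, hr, hc, h⟩
    choose h1 h2 h3 using h
    choose R C hT hR hC using h1
    refine ⟨R, fun a => C a.rev, fun a b hab => ?_, fun a b hab => ?_, fun a b => ?_, fun a => ?_⟩
    · have := hr hab
      rw [hR, hR] at this
      exact this
    · have := hc (Fin.rev_lt_rev.2 hab)
      rw [hC, hC] at this
      exact Fin.rev_lt_rev.1 this
    · have h4 := h2 a
      have h5 : c b.rev < _ := h3 b.rev
      rw [hR] at h4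
      rw [hC] at h5
      exact hY _ _ _ _ hij (Fin.le_def.2 (by omega))
        (Fin.rev_le_rev.1 (Fin.le_def.2 (Nat.lt_succ_iff.1 h5)))
    · simpa using hT a
  · rintro ⟨R, C, hR, hC, hY', hT⟩
    refine ⟨R (Fin.last k), (C 0).rev, reflectCells_coe_rev.2 (hY' _ _), fun a => R a,
      fun a => (C a.rev).rev, fun a b hab => hR hab,
      fun a b hab => Fin.rev_lt_rev.2 (hC (Fin.rev_lt_rev.2 hab)), fun a =>
      ⟨reflectCells_coe_rev.2 (hT a), Nat.lt_succ_of_le (hR.monotone (Fin.le_last a)),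
        Nat.lt_succ_of_le (Fin.rev_le_rev.2 (hC.monotone (Fin.zero_le _)))⟩⟩

lemma exists_hasDecreasing_reflectCells_iff {n k : ℕ} {Y T : Fin n → Fin n → Prop}
    (hY : ∀ i j i' j', Y i j → i' ≤ i → j ≤ j' → Y i' j') :
    (∃ p q, reflectCells Y p q ∧ HasDecreasing (reflectCells T) (k + 1) (p + 1) (q + 1)) ↔
      ∃ R C : Fin (k + 1) → Fin n, StrictMono R ∧ StrictMono C ∧ (∀ a b, Y (R a) (C b)) ∧
        ∀ a, T (R a) (C a) := by
  constructor
  · rintro ⟨p, q, ⟨i, j, hij, rfl, rfl⟩, r, c, hr, hc, h⟩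
    choose h1 h2 h3 using h
    choose R C hT hR hC using h1
    refine ⟨R, C, fun a b hab => ?_, fun a b hab => ?_, fun a b => ?_, hT⟩
    · have := hr hab
      rw [hR, hR] at this
      exact this
    · have := hc hab
      rw [hC, hC] at this
      exact Fin.rev_lt_rev.1 this
    · have h4 := h2 a
      have h5 := h3 b
      rw [hR] at h4
      rw [hC] at h5
      exact hY _ _ _ _ hij (Fin.le_def.2 (by omega))
        (Fin.rev_le_rev.1 (Fin.le_def.2 (by omega)))
  · rintro ⟨R, C, hR, hC, hY', hT⟩
    refine ⟨R (Fin.last k), (C 0).rev, reflectCells_coe_rev.2 (hY' _ _), fun a => R a,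
      fun a => (C a).rev, fun a b hab => hR hab, fun a b hab => Fin.rev_lt_rev.2 (hC hab), fun a =>
      ⟨reflectCells_coe_rev.2 (hT a), Nat.lt_succ_of_le (hR.monotone (Fin.le_last a)),
        Nat.lt_succ_of_le (Fin.rev_le_rev.2 (hC.monotone (Fin.zero_le _)))⟩⟩

/-- On partial permutations inside a north-east closed set of cells there is an involution that
preserves the occupied rows and columns and exchanges the two kinds of chains. -/
theorem exists_cells_involution {n : ℕ} (Y : Fin n → Fin n → Prop)
    (hY : ∀ i j i' j', Y i j → i' ≤ i → j ≤ j' → Y i' j') :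
    ∃ Φ : (Fin n → Fin n → Prop) → Fin n → Fin n → Prop, ∀ T : Fin n → Fin n → Prop,
      (∀ i j, T i j → Y i j) → (∀ i j j', T i j → T i j' → j = j') →
      (∀ i i' j, T i j → T i' j → i = i') →
      (∀ i j, Φ T i j → Y i j) ∧ (∀ i j j', Φ T i j → Φ T i j' → j = j') ∧
      (∀ i i' j, Φ T i j → Φ T i' j → i = i') ∧ Φ (Φ T) = T ∧
      (∀ i, (∃ j, Φ T i j) ↔ ∃ j, T i j) ∧ (∀ j, (∃ i, Φ T i j) ↔ ∃ i, T i j) ∧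
      ∀ k, (∃ R C : Fin (k + 1) → Fin n, StrictMono R ∧ StrictMono C ∧ (∀ a b, Y (R a) (C b)) ∧
          ∀ a, T (R a) (C a.rev)) ↔
        ∃ R C : Fin (k + 1) → Fin n, StrictMono R ∧ StrictMono C ∧ (∀ a b, Y (R a) (C b)) ∧
          ∀ a, Φ T (R a) (C a) := by
  classical
  set Z : Finset (ℕ × ℕ) := ((Finset.range n) ×ˢ (Finset.range n)).filter
    fun x => reflectCells Y x.1 x.2 with hZ
  have hmem : ∀ p q, (p, q) ∈ Z ↔ reflectCells Y p q := fun p q => by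
    simp only [hZ, Finset.mem_filter, Finset.mem_product, Finset.mem_range, and_iff_right_iff_imp]
    rintro ⟨i, j, -, rfl, rfl⟩
    exact ⟨i.2, j.rev.2⟩
  have hlow : IsLowerSet (Z : Set (ℕ × ℕ)) := by
    rintro ⟨p, q⟩ ⟨p', q'⟩ hle h
    obtain ⟨i, j, hij, rfl, rfl⟩ := (hmem p q).1 h
    obtain ⟨h1, h2⟩ : p' ≤ (i : ℕ) ∧ q' ≤ (j.rev : ℕ) := hle
    refine (hmem _ _).2 ⟨⟨p', h1.trans_lt i.2⟩, Fin.rev ⟨q', h2.trans_lt j.rev.2⟩,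
      hY _ _ _ _ hij h1 ?_, rfl, by simp⟩
    rw [Fin.le_rev_iff]
    exact h2
  obtain ⟨Ψ, hΨ⟩ := exists_filling_involution hlow
  refine ⟨fun T i j => Ψ (reflectCells T) i j.rev, fun T hT hrow hcol => ?_⟩
  have hfill : IsFilling Z (reflectCells T) := by
    refine ⟨⟨?_, ?_⟩, ?_⟩
    · rintro _ _ _ ⟨i, j, h, rfl, rfl⟩ ⟨i', j', h', h1, rfl⟩
      obtain rfl := Fin.ext h1
      rw [hrow _ _ _ h h']
    · rintro _ _ _ ⟨i, j, h, rfl, rfl⟩ ⟨i', j', h', rfl, h1⟩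
      obtain rfl := Fin.rev_injective (Fin.ext h1)
      rw [hcol _ _ _ h h']
    · rintro _ _ ⟨i, j, h, rfl, rfl⟩
      exact (hmem _ _).2 (reflectCells_coe_rev.2 (hT _ _ h))
  obtain ⟨h1, h2, h3, h4, h5⟩ := hΨ _ hfill
  have hsub : ∀ p q, Ψ (reflectCells T) p q → reflectCells Y p q := fun p q h =>
    (hmem p q).1 (h1.mem h)
  have heq := reflectCells_unreflect hsub
  refine ⟨fun i j h => reflectCells_coe_rev.1 (hsub _ _ h),
    fun i j j' h h' => Fin.rev_injective (Fin.ext (h1.isPartialPerm.row h h')),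
    fun i i' j h h' => Fin.ext (h1.isPartialPerm.col h h'), ?_, fun i => ?_, fun j => ?_,
    fun k => ?_⟩
  · funext i j
    beta_reduce
    rw [heq, h2]
    exact propext reflectCells_coe_rev
  · have h6 : (∃ j : Fin n, Ψ (reflectCells T) i j.rev) ↔ ∃ q, Ψ (reflectCells T) i q := by
      refine ⟨fun ⟨j, h⟩ => ⟨_, h⟩, fun ⟨q, h⟩ => ?_⟩
      obtain ⟨i', j, -, -, rfl⟩ := hsub _ _ h
      exact ⟨j, h⟩
    have h7 : (∃ j : Fin n, T i j) ↔ ∃ q, reflectCells T i q := by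
      refine ⟨fun ⟨j, h⟩ => ⟨_, reflectCells_coe_rev.2 h⟩, ?_⟩
      rintro ⟨_, i', j, h, hi, rfl⟩
      exact ⟨j, by rwa [Fin.ext hi]⟩
    rw [h6, h7, h3]
  · have h6 : (∃ i : Fin n, Ψ (reflectCells T) i j.rev) ↔ ∃ p, Ψ (reflectCells T) p j.rev := by
      refine ⟨fun ⟨j, h⟩ => ⟨_, h⟩, fun ⟨q, h⟩ => ?_⟩
      obtain ⟨i, j', -, rfl, -⟩ := hsub _ _ h
      exact ⟨i, h⟩
    have h7 : (∃ i : Fin n, T i j) ↔ ∃ p, reflectCells T p j.rev := by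
      refine ⟨fun ⟨j, h⟩ => ⟨_, reflectCells_coe_rev.2 h⟩, ?_⟩
      rintro ⟨_, i, j', h, rfl, hj⟩
      exact ⟨i, by rwa [Fin.rev_injective (Fin.ext hj)]⟩
    rw [h6, h7, h4]
  · rw [← exists_hasIncreasing_reflectCells_iff hY, ← exists_hasDecreasing_reflectCells_iff
      (T := fun i j : Fin n => Ψ (reflectCells T) i j.rev) hY, heq]
    simpa only [hmem] using h5 k

lemma IsSignedPermMatrix.row_unique {n : ℕ} {M : Matrix (Fin n) (Fin n) ℤ}
    (hM : IsSignedPermMatrix M) {i j j' : Fin n} (h : M i j ≠ 0) (h' : M i j' ≠ 0) : j = j' :=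
  (hM.2.1 i).unique h h'

lemma IsSignedPermMatrix.col_unique {n : ℕ} {M : Matrix (Fin n) (Fin n) ℤ}
    (hM : IsSignedPermMatrix M) {i i' j : Fin n} (h1 : M i j ≠ 0) (h2 : M i' j ≠ 0) : i = i' :=
  (hM.2.2 j).unique h1 h2

/-- `M` contains `σ` in a submatrix lying strictly above the diagonal. -/
def ContainsAbove {n k : ℕ} (M : Matrix (Fin n) (Fin n) ℤ) (σ : Matrix (Fin k) (Fin k) ℤ) : Prop :=
  ∃ r c : Fin k → Fin n, StrictMono r ∧ StrictMono c ∧ (∀ a b, r a < c b) ∧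
    ∀ a b, M (r a) (c b) = σ a b

lemma strictMono_append {α : Type*} [Preorder α] {a b : ℕ} {f : Fin a → α} {g : Fin b → α}
    (hf : StrictMono f) (hg : StrictMono g) (hfg : ∀ i j, f i < g j) :
    StrictMono (Fin.append f g) := by
  intro x y hxy
  induction x using Fin.addCases with
  | left i =>
    induction y using Fin.addCases with
    | left j =>
      rw [Fin.append_left, Fin.append_left]
      exact hf (by rwa [Fin.lt_def] at hxy ⊢)
    | right j =>
      rw [Fin.append_left, Fin.append_right]
      exact hfg i j
  | right i =>
    induction y using Fin.addCases with
    | left j =>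
      have := Fin.lt_def.1 hxy
      simp only [Fin.val_natAdd, Fin.val_castAdd] at this
      omega
    | right j =>
      rw [Fin.append_right, Fin.append_right]
      rw [Fin.lt_def, Fin.val_natAdd, Fin.val_natAdd] at hxy
      exact hg (Fin.lt_def.2 (by omega))

section primePat

variable {k : ℕ} (σ : Matrix (Fin k) (Fin k) ℤ) (a b : Fin k)

lemma primePat_left_left : primePat σ (Fin.castAdd k a) (Fin.castAdd k b) = 0 := by
  simp [primePat, -Fin.natAdd_eq_addNat]

lemma primePat_left_right : primePat σ (Fin.castAdd k a) (Fin.natAdd k b) = σ a b := by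
  simp [primePat, -Fin.natAdd_eq_addNat]

lemma primePat_right_left : primePat σ (Fin.natAdd k a) (Fin.castAdd k b) = σ b a := by
  simp [primePat, -Fin.natAdd_eq_addNat]

lemma primePat_right_right : primePat σ (Fin.natAdd k a) (Fin.natAdd k b) = 0 := by
  simp [primePat, -Fin.natAdd_eq_addNat]

end primePat

lemma containsPattern_primePat_iff {n k : ℕ} {M : Matrix (Fin n) (Fin n) ℤ}
    (hM : IsSignedPermMatrix M) (hsymm : M.IsSymm) {σ : Matrix (Fin k) (Fin k) ℤ}
    (hrow : ∀ a, ∃ b, σ a b ≠ 0) (hcol : ∀ b, ∃ a, σ a b ≠ 0) :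
    ContainsPattern M (primePat σ) ↔ ContainsAbove M σ := by
  constructor
  · rintro ⟨r, c, hr, hc, h⟩
    have hleft : StrictMono (Fin.castAdd k : Fin k → Fin (k + k)) := Fin.strictMono_castAdd k
    have hright : StrictMono (Fin.natAdd k : Fin k → Fin (k + k)) := Fin.strictMono_natAdd k
    have hlt : ∀ a b : Fin k, Fin.castAdd k a < Fin.natAdd k b := fun a b => by
      rw [Fin.lt_def, Fin.val_castAdd, Fin.val_natAdd]
      omega
    by_cases hlt' : ∀ a b : Fin k, r (Fin.castAdd k a) < c (Fin.natAdd k b)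
    · exact ⟨_, _, hr.comp hleft, hc.comp hright, hlt', fun a b => by
        rw [← primePat_left_right σ]
        exact h _ _⟩
    · push Not at hlt'
      obtain ⟨a, b, hab⟩ := hlt'
      refine ⟨_, _, hc.comp hleft, hr.comp hright, fun a' b' =>
        ((hc (hlt a' b)).trans_le hab).trans (hr (hlt a b')), fun a' b' => ?_⟩
      rw [← primePat_right_left σ, ← h]
      exact hsymm.apply _ _
  · rintro ⟨r, c, hr, hc, hlt, h⟩
    refine ⟨Fin.append r c, Fin.append r c, strictMono_append hr hc hlt,
      strictMono_append hr hc hlt, fun x y => ?_⟩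
    induction x using Fin.addCases with
    | left a =>
      induction y using Fin.addCases with
      | left b =>
        rw [primePat_left_left, Fin.append_left, Fin.append_left]
        obtain ⟨b', hb'⟩ := hrow a
        rw [← h] at hb'
        by_contra hne
        exact (hlt b b').ne (hM.row_unique hne hb')
      | right b => rw [primePat_left_right, Fin.append_left, Fin.append_right, h]
    | right a =>
      induction y using Fin.addCases with
      | left b => rw [primePat_right_left, Fin.append_left, Fin.append_right, hsymm.apply, h]
      | right b =>
        rw [primePat_right_right, Fin.append_right, Fin.append_right]
        obtain ⟨a', ha'⟩ := hcol b
        rw [← h] at ha'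
        by_contra hne
        exact (hlt a' a).ne (hM.col_unique ha' hne)

section antiBlock2

variable {k m : ℕ} (A : Matrix (Fin k) (Fin k) ℤ) (χ : Matrix (Fin m) (Fin m) ℤ)

lemma antiBlock2_left_left (a : Fin k) (b : Fin m) :
    antiBlock2 A χ (Fin.castAdd m a) ((Fin.castAdd k b).cast (Nat.add_comm m k)) = 0 := by
  simp [antiBlock2]

lemma antiBlock2_left_right (a b : Fin k) :
    antiBlock2 A χ (Fin.castAdd m a) ((Fin.natAdd m b).cast (Nat.add_comm m k)) = A a b := by
  simp [antiBlock2]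

lemma antiBlock2_right_left (a b : Fin m) :
    antiBlock2 A χ (Fin.natAdd k a) ((Fin.castAdd k b).cast (Nat.add_comm m k)) = χ a b := by
  simp [antiBlock2]

lemma antiBlock2_right_right (a : Fin m) (b : Fin k) :
    antiBlock2 A χ (Fin.natAdd k a) ((Fin.natAdd m b).cast (Nat.add_comm m k)) = 0 := by
  simp [antiBlock2]

variable {A χ}

lemma exists_antiBlock2_row_ne_zero (hA : ∀ a, ∃ b, A a b ≠ 0) (hχ : ∀ a, ∃ b, χ a b ≠ 0)
    (x : Fin (k + m)) : ∃ y, antiBlock2 A χ x y ≠ 0 := by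
  induction x using Fin.addCases with
  | left a =>
    obtain ⟨b, hb⟩ := hA a
    exact ⟨_, by rwa [← antiBlock2_left_right A χ] at hb⟩
  | right a =>
    obtain ⟨b, hb⟩ := hχ a
    exact ⟨_, by rwa [← antiBlock2_right_left A χ] at hb⟩

lemma exists_antiBlock2_col_ne_zero (hA : ∀ b, ∃ a, A a b ≠ 0) (hχ : ∀ b, ∃ a, χ a b ≠ 0)
    (y : Fin (k + m)) : ∃ x, antiBlock2 A χ x y ≠ 0 := by
  obtain ⟨y, rfl⟩ : ∃ z : Fin (m + k), z.cast (Nat.add_comm m k) = y :=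
    ⟨y.cast (Nat.add_comm k m), by simp⟩
  induction y using Fin.addCases with
  | left b =>
    obtain ⟨a, ha⟩ := hχ b
    exact ⟨_, by rwa [← antiBlock2_right_left A χ] at ha⟩
  | right b =>
    obtain ⟨a, ha⟩ := hA b
    exact ⟨_, by rwa [← antiBlock2_left_right A χ] at ha⟩

end antiBlock2

/-- The cells strictly above the diagonal that have an occurrence of `χ`, itself strictly above the
diagonal, strictly to their south-west. -/
def IsCornerOf {n m : ℕ} (M : Matrix (Fin n) (Fin n) ℤ) (χ : Matrix (Fin m) (Fin m) ℤ)
    (i j : Fin n) : Prop :=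
  i < j ∧ ∃ r c : Fin m → Fin n, StrictMono r ∧ StrictMono c ∧ (∀ a, i < r a) ∧ (∀ b, c b < j) ∧
    (∀ a b, r a < c b) ∧ ∀ a b, M (r a) (c b) = χ a b

section IsCornerOf

variable {n m k : ℕ} {M M' : Matrix (Fin n) (Fin n) ℤ} {χ : Matrix (Fin m) (Fin m) ℤ}

lemma IsCornerOf.mono {i j i' j' : Fin n} (h : IsCornerOf M χ i j) (hi : i' ≤ i) (hj : j ≤ j') :
    IsCornerOf M χ i' j' := by
  obtain ⟨hij, r, c, hr, hc, h1, h2, h3⟩ := h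
  exact ⟨(hi.trans_lt hij).trans_le hj, r, c, hr, hc, fun a => hi.trans_lt (h1 a),
    fun b => (h2 b).trans_le hj, h3⟩

lemma IsCornerOf.exists_not_isCornerOf {i j : Fin n} (h : IsCornerOf M χ i j) :
    ∃ r c : Fin m → Fin n, StrictMono r ∧ StrictMono c ∧ (∀ a, i < r a) ∧ (∀ b, c b < j) ∧
      (∀ a b, r a < c b) ∧ (∀ a b, M (r a) (c b) = χ a b) ∧ ∀ a b, ¬ IsCornerOf M χ (r a) (c b) := by
  induction i using WellFoundedGT.induction generalizing j with
  | ind i ih =>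
    obtain ⟨hij, r, c, hr, hc, h1, h2, h3, h4⟩ := h
    by_cases hex : ∃ a b, IsCornerOf M χ (r a) (c b)
    · obtain ⟨a, b, hab⟩ := hex
      obtain ⟨r', c', hr', hc', h1', h2', h3'⟩ := ih (r a) (h1 a) hab
      exact ⟨r', c', hr', hc', fun x => (h1 a).trans (h1' x), fun x => (h2' x).trans (h2 b), h3'⟩
    · push Not at hex
      exact ⟨r, c, hr, hc, h1, h2, h3, h4, hex⟩

/-- Changing entries only in corner cells and their transposes does not change the corners. -/
lemma isCornerOf_iff_of_eq (h : ∀ i j, ¬ IsCornerOf M χ i j → ¬ IsCornerOf M χ j i → M' i j = M i j)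
    (i j : Fin n) : IsCornerOf M' χ i j ↔ IsCornerOf M χ i j := by
  have heq : ∀ i j, i < j → ¬ IsCornerOf M χ i j → M' i j = M i j := fun i j hij hn =>
    h i j hn fun hji => hij.not_gt hji.1
  constructor
  · rintro ⟨hij, r, c, hr, hc, h1, h2, h3, h4⟩
    by_cases hex : ∃ a b, IsCornerOf M χ (r a) (c b)
    · obtain ⟨a, b, hab⟩ := hex
      exact hab.mono (h1 a).le (h2 b).le
    · push Not at hex
      exact ⟨hij, r, c, hr, hc, h1, h2, h3, fun a b => by
        rw [← heq _ _ (h3 a b) (hex a b), h4]⟩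
  · intro hc
    obtain ⟨r, c, hr, hc', h1, h2, h3, h4, h5⟩ := hc.exists_not_isCornerOf
    exact ⟨hc.1, r, c, hr, hc', h1, h2, h3, fun a b => by rw [heq _ _ (h3 a b) (h5 a b), h4]⟩

lemma containsAbove_antiBlock2_iff (hM : IsSignedPermMatrix M)
    {A : Matrix (Fin (k + 1)) (Fin (k + 1)) ℤ} (hrow : ∀ a, ∃ b, A a b ≠ 0)
    (hcol : ∀ b, ∃ a, A a b ≠ 0) :
    ContainsAbove M (antiBlock2 A χ) ↔
      ∃ R C : Fin (k + 1) → Fin n, StrictMono R ∧ StrictMono C ∧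
        (∀ a b, IsCornerOf M χ (R a) (C b)) ∧ ∀ a b, M (R a) (C b) = A a b := by
  have hcast : StrictMono (Fin.cast (Nat.add_comm m (k + 1))) := fun a b hab => hab
  have hcast' : StrictMono (Fin.cast (Nat.add_comm (k + 1) m)) := fun a b hab => hab
  constructor
  · rintro ⟨r, c, hr, hc, hlt, h⟩
    refine ⟨_, _, hr.comp (Fin.strictMono_castAdd m),
      (hc.comp hcast).comp (Fin.strictMono_natAdd m), fun a b => ⟨hlt _ _, _, _,
      hr.comp (Fin.strictMono_natAdd (k + 1)),
      (hc.comp hcast).comp (Fin.strictMono_castAdd (k + 1)), fun x => hr ?_, fun x => hc ?_,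
      fun x y => hlt _ _, fun x y => ?_⟩, fun a b => ?_⟩
    · rw [Fin.lt_def, Fin.val_castAdd, Fin.val_natAdd]
      omega
    · refine hcast ?_
      rw [Fin.lt_def, Fin.val_castAdd, Fin.val_natAdd]
      omega
    · rw [← antiBlock2_right_left A χ]
      exact h _ _
    · rw [← antiBlock2_left_right A χ]
      exact h _ _
  · rintro ⟨R, C, hR, hC, hcor, h⟩
    obtain ⟨-, r, c, hr, hc, h1, h2, h3, h4⟩ := hcor (Fin.last k) 0
    have h1' : ∀ a x, R a < r x := fun a x => (hR.monotone (Fin.le_last a)).trans_lt (h1 x)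
    have h2' : ∀ x b, c x < C b := fun x b => (h2 x).trans_le (hC.monotone (Fin.zero_le b))
    refine ⟨Fin.append R r, fun y => Fin.append c C (y.cast (Nat.add_comm (k + 1) m)),
      strictMono_append hR hr h1', (strictMono_append hc hC h2').comp hcast',
      fun x y => ?_, fun x y => ?_⟩
    all_goals
      obtain ⟨y, rfl⟩ : ∃ z : Fin (m + (k + 1)), z.cast (Nat.add_comm m (k + 1)) = y :=
        ⟨y.cast (Nat.add_comm (k + 1) m), by simp⟩
      simp only [Fin.cast_cast, Fin.cast_eq_self]
    · induction x using Fin.addCases with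
      | left a =>
        induction y using Fin.addCases with
        | left b =>
          rw [Fin.append_left, Fin.append_left]
          exact (h1' a b).trans (h3 b b)
        | right b =>
          rw [Fin.append_left, Fin.append_right]
          exact (hcor a b).1
      | right a =>
        induction y using Fin.addCases with
        | left b =>
          rw [Fin.append_left, Fin.append_right]
          exact h3 a b
        | right b =>
          rw [Fin.append_right, Fin.append_right]
          exact (h3 a a).trans (h2' a b)
    · induction x using Fin.addCases with
      | left a =>
        induction y using Fin.addCases with
        | left b =>
          rw [antiBlock2_left_left, Fin.append_left, Fin.append_left]
          obtain ⟨b', hb'⟩ := hrow a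
          rw [← h] at hb'
          by_contra hne
          exact (h2' b b').ne (hM.row_unique hne hb')
        | right b => rw [antiBlock2_left_right, Fin.append_left, Fin.append_right, h]
      | right a =>
        induction y using Fin.addCases with
        | left b => rw [antiBlock2_right_left, Fin.append_left, Fin.append_right, h4]
        | right b =>
          rw [antiBlock2_right_right, Fin.append_right, Fin.append_right]
          obtain ⟨a', ha'⟩ := hcol b
          rw [← h] at ha'
          by_contra hne
          exact (h1' a' a).ne (hM.col_unique ha' hne)

end IsCornerOf

open Classical in
/-- Replace the ones of `M` in the cells of `S` by ones in the cells of `S'`. -/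
noncomputable def moveOnes {n : ℕ} (M : Matrix (Fin n) (Fin n) ℤ) (S S' : Fin n → Fin n → Prop) :
    Matrix (Fin n) (Fin n) ℤ :=
  Matrix.of fun i j => if S' i j then 1 else if S i j then 0 else M i j

section moveOnes

variable {n : ℕ} {M : Matrix (Fin n) (Fin n) ℤ} {S S' : Fin n → Fin n → Prop}

lemma moveOnes_of_mem {i j : Fin n} (h : S' i j) : moveOnes M S S' i j = 1 := by
  simp [moveOnes, h]

lemma moveOnes_of_mem_left {i j : Fin n} (h' : ¬ S' i j) (h : S i j) :
    moveOnes M S S' i j = 0 := by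
  simp [moveOnes, h, h']

lemma moveOnes_of_not_mem {i j : Fin n} (h' : ¬ S' i j) (h : ¬ S i j) :
    moveOnes M S S' i j = M i j := by
  simp [moveOnes, h, h']

lemma moveOnes_isSymm (hsymm : M.IsSymm) (hS : ∀ i j, S i j → S j i)
    (hS' : ∀ i j, S' i j → S' j i) : (moveOnes M S S').IsSymm := by
  refine Matrix.IsSymm.ext fun i j => ?_
  have h : S j i ↔ S i j := ⟨hS j i, hS i j⟩
  have h' : S' j i ↔ S' i j := ⟨hS' j i, hS' i j⟩
  simp only [moveOnes, Matrix.of_apply, hsymm.apply]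
  congr 1
  · exact propext h'
  · rw [propext h]

lemma moveOnes_isSignedPermMatrix (hM : IsSignedPermMatrix M) (hsymm : M.IsSymm)
    (hS : ∀ i j, S i j → S j i) (hS' : ∀ i j, S' i j → S' j i) (hone : ∀ i j, S i j → M i j = 1)
    (huniq : ∀ i j j', S' i j → S' i j' → j = j')
    (hsupp : ∀ i, (∃ j, S' i j) ↔ ∃ j, S i j) : IsSignedPermMatrix (moveOnes M S S') := by
  have hrow : ∀ i, ∃! j, moveOnes M S S' i j ≠ 0 := by
    intro i
    by_cases hex : ∃ j, S' i j
    · obtain ⟨x, hx⟩ := (hsupp i).1 hex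
      obtain ⟨j, hj⟩ := hex
      refine ⟨j, by simp [moveOnes_of_mem hj], fun j' hj' => ?_⟩
      by_cases h' : S' i j'
      · exact huniq _ _ _ h' hj
      · by_cases h : S i j'
        · exact absurd (moveOnes_of_mem_left h' h) hj'
        · have hne : M i j' ≠ 0 := fun h0 => hj' ((moveOnes_of_not_mem h' h).trans h0)
          have : x = j' := hM.row_unique (by simp [hone _ _ hx]) hne
          exact absurd (this ▸ hx) h
    · have heq : ∀ j, moveOnes M S S' i j = M i j := fun j =>
        moveOnes_of_not_mem (fun h => hex ⟨j, h⟩) fun h => hex ((hsupp i).2 ⟨j, h⟩)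
      simpa only [heq] using hM.2.1 i
  refine ⟨fun i j => ?_, hrow, fun j => ?_⟩
  · simp only [moveOnes, Matrix.of_apply]
    split_ifs
    · simp
    · simp
    · exact hM.1 i j
  · simpa only [(moveOnes_isSymm hsymm hS hS').apply] using hrow j

lemma moveOnes_moveOnes (hM : IsSignedPermMatrix M) (hone : ∀ i j, S i j → M i j = 1)
    (hsupp : ∀ i, (∃ j, S' i j) ↔ ∃ j, S i j) : moveOnes (moveOnes M S S') S' S = M := by
  ext i j
  by_cases h : S i j
  · rw [moveOnes_of_mem h, hone i j h]
  · by_cases h' : S' i j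
    · rw [moveOnes_of_mem_left h h']
      obtain ⟨x, hx⟩ := (hsupp i).1 ⟨j, h'⟩
      by_contra hne
      have : x = j := hM.row_unique (by simp [hone _ _ hx]) (Ne.symm hne)
      exact h (this ▸ hx)
    · rw [moveOnes_of_not_mem h h', moveOnes_of_not_mem h' h]

end moveOnes

section cornerOnes

variable {n m : ℕ}

/-- The corner cells containing a one. -/
def cornerOnes (M : Matrix (Fin n) (Fin n) ℤ) (χ : Matrix (Fin m) (Fin m) ℤ) (i j : Fin n) :
    Prop :=
  IsCornerOf M χ i j ∧ M i j = 1

/-- The symmetric closure of a set of cells. -/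
def symmCells (T : Fin n → Fin n → Prop) (i j : Fin n) : Prop := T i j ∨ T j i

lemma symmCells_symm {T : Fin n → Fin n → Prop} (i j : Fin n) (h : symmCells T i j) :
    symmCells T j i := h.symm

variable {M : Matrix (Fin n) (Fin n) ℤ} {χ : Matrix (Fin m) (Fin m) ℤ}
  {T : Fin n → Fin n → Prop}

lemma eq_one_of_symmCells (hsymm : M.IsSymm) (i j : Fin n)
    (h : symmCells (cornerOnes M χ) i j) : M i j = 1 := by
  rcases h with h | h
  · exact h.2
  · rw [← hsymm.apply]
    exact h.2

lemma symmCells_row_iff (hrow : ∀ i, (∃ j, T i j) ↔ ∃ j, cornerOnes M χ i j)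
    (hcol : ∀ j, (∃ i, T i j) ↔ ∃ i, cornerOnes M χ i j) (i : Fin n) :
    (∃ j, symmCells T i j) ↔ ∃ j, symmCells (cornerOnes M χ) i j := by
  simp only [symmCells, exists_or, hrow, hcol]

lemma symmCells_unique (hM : IsSignedPermMatrix M) (hsymm : M.IsSymm)
    (h1 : ∀ i j j', T i j → T i j' → j = j') (h2 : ∀ i i' j, T i j → T i' j → i = i')
    (hrow : ∀ i, (∃ j, T i j) ↔ ∃ j, cornerOnes M χ i j)
    (hcol : ∀ j, (∃ i, T i j) ↔ ∃ i, cornerOnes M χ i j) (i j j' : Fin n)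
    (h : symmCells T i j) (h' : symmCells T i j') : j = j' := by
  have hne : ∀ j j', T i j → T j' i → False := fun j j' h h' => by
    obtain ⟨x, hx⟩ := (hrow i).1 ⟨j, h⟩
    obtain ⟨y, hy⟩ := (hcol i).1 ⟨j', h'⟩
    have hxy : x = y := hM.row_unique (i := i) (by simp [hx.2])
      (by rw [← hsymm.apply]; simp [hy.2])
    exact (hx.1.1.trans (hxy ▸ hy.1.1)).false
  rcases h with h | h <;> rcases h' with h' | h'
  · exact h1 _ _ _ h h'
  · exact (hne _ _ h h').elim
  · exact (hne _ _ h' h).elim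
  · exact h2 _ _ _ h h'

lemma isCornerOf_moveOnes (hT : ∀ i j, T i j → IsCornerOf M χ i j) :
    IsCornerOf (moveOnes M (symmCells (cornerOnes M χ)) (symmCells T)) χ = IsCornerOf M χ := by
  funext i j
  refine propext (isCornerOf_iff_of_eq (fun i j h h' => moveOnes_of_not_mem ?_ ?_) i j)
  · rintro (h'' | h'')
    · exact h (hT _ _ h'')
    · exact h' (hT _ _ h'')
  · rintro (h'' | h'')
    · exact h h''.1
    · exact h' h''.1

lemma cornerOnes_moveOnes (hT : ∀ i j, T i j → IsCornerOf M χ i j) :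
    cornerOnes (moveOnes M (symmCells (cornerOnes M χ)) (symmCells T)) χ = T := by
  funext i j
  rw [cornerOnes, isCornerOf_moveOnes hT]
  refine propext ⟨fun ⟨h, h1⟩ => ?_, fun h => ⟨hT _ _ h, moveOnes_of_mem (.inl h)⟩⟩
  by_contra hn
  have hn' : ¬ symmCells T i j := by
    rintro (h' | h')
    · exact hn h'
    · exact h.1.not_gt (hT _ _ h').1
  by_cases hc : symmCells (cornerOnes M χ) i j
  · simp [moveOnes_of_mem_left hn' hc] at h1
  · rw [moveOnes_of_not_mem hn' hc] at h1
    exact hc (.inl ⟨h, h1⟩)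

lemma forall_eq_iff_of_ne_zero {k : ℕ} (hM : IsSignedPermMatrix M)
    {A : Matrix (Fin k) (Fin k) ℤ} (hrow : ∀ a, ∃ b, A a b ≠ 0) {R C : Fin k → Fin n}
    (hC : StrictMono C) :
    (∀ a b, M (R a) (C b) = A a b) ↔ ∀ a b, A a b ≠ 0 → M (R a) (C b) = A a b := by
  refine ⟨fun h a b _ => h a b, fun h a b => ?_⟩
  by_cases hab : A a b = 0
  · obtain ⟨b', hb'⟩ := hrow a
    rw [hab]
    by_contra hne
    have := hC.injective (hM.row_unique hne (by rwa [h a b' hb']))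
    exact hb' (this ▸ hab)
  · exact h a b hab

lemma containsPattern_one_iff (hM : IsSignedPermMatrix M) (hsymm : M.IsSymm)
    (hχ : IsSignedPermMatrix χ) (k : ℕ) :
    ContainsPattern M (primePat (antiBlock2 (1 : Matrix (Fin (k + 1)) (Fin (k + 1)) ℤ) χ)) ↔
      ∃ R C : Fin (k + 1) → Fin n, StrictMono R ∧ StrictMono C ∧
        (∀ a b, IsCornerOf M χ (R a) (C b)) ∧ ∀ a, cornerOnes M χ (R a) (C a) := by
  have hrow : ∀ a, ∃ b, (1 : Matrix (Fin (k + 1)) (Fin (k + 1)) ℤ) a b ≠ 0 := fun a =>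
    ⟨a, by simp⟩
  have hcol : ∀ b, ∃ a, (1 : Matrix (Fin (k + 1)) (Fin (k + 1)) ℤ) a b ≠ 0 := fun a =>
    ⟨a, by simp⟩
  rw [containsPattern_primePat_iff hM hsymm
      (exists_antiBlock2_row_ne_zero hrow fun a => (hχ.2.1 a).exists)
      (exists_antiBlock2_col_ne_zero hcol fun a => (hχ.2.2 a).exists),
    containsAbove_antiBlock2_iff hM hrow hcol]
  refine exists₂_congr fun R C => and_congr_right fun _ => and_congr_right fun hC =>
    and_congr_right fun hcor => ?_
  rw [forall_eq_iff_of_ne_zero hM hrow hC]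
  simp [Matrix.one_apply, cornerOnes, hcor]

lemma betaMat_apply {k : ℕ} (a b : Fin k) : betaMat k a b = if b = a.rev then 1 else 0 := by
  have : (a : ℕ) + b + 1 = k ↔ b = a.rev := by
    rw [Fin.ext_iff, Fin.val_rev]
    omega
  simp [betaMat, this]

lemma containsPattern_betaMat_iff (hM : IsSignedPermMatrix M) (hsymm : M.IsSymm)
    (hχ : IsSignedPermMatrix χ) (k : ℕ) :
    ContainsPattern M (primePat (antiBlock2 (betaMat (k + 1)) χ)) ↔
      ∃ R C : Fin (k + 1) → Fin n, StrictMono R ∧ StrictMono C ∧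
        (∀ a b, IsCornerOf M χ (R a) (C b)) ∧ ∀ a, cornerOnes M χ (R a) (C a.rev) := by
  have hrow : ∀ a, ∃ b, betaMat (k + 1) a b ≠ 0 := fun a => ⟨a.rev, by simp [betaMat_apply]⟩
  have hcol : ∀ b, ∃ a, betaMat (k + 1) a b ≠ 0 := fun a => ⟨a.rev, by simp [betaMat_apply]⟩
  rw [containsPattern_primePat_iff hM hsymm
      (exists_antiBlock2_row_ne_zero hrow fun a => (hχ.2.1 a).exists)
      (exists_antiBlock2_col_ne_zero hcol fun a => (hχ.2.2 a).exists),
    containsAbove_antiBlock2_iff hM hrow hcol]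
  refine exists₂_congr fun R C => and_congr_right fun _ => and_congr_right fun hC =>
    and_congr_right fun hcor => ?_
  rw [forall_eq_iff_of_ne_zero hM hrow hC]
  simp [betaMat_apply, cornerOnes, hcor]

/-- An involution on signed involutions exchanging the occurrences of the two patterns. -/
theorem exists_matrix_involution (n k : ℕ) (hχ : IsSignedPermMatrix χ) :
    ∃ F : Matrix (Fin n) (Fin n) ℤ → Matrix (Fin n) (Fin n) ℤ,
      ∀ M, IsSignedPermMatrix M → M.IsSymm →
        IsSignedPermMatrix (F M) ∧ (F M).IsSymm ∧ F (F M) = M ∧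
        (ContainsPattern M (primePat (antiBlock2 (betaMat (k + 1)) χ)) ↔ ContainsPattern (F M)
          (primePat (antiBlock2 (1 : Matrix (Fin (k + 1)) (Fin (k + 1)) ℤ) χ))) := by
  choose! Φ hΦ using exists_cells_involution (n := n)
  have hmono : ∀ M : Matrix (Fin n) (Fin n) ℤ, ∀ i j i' j', IsCornerOf M χ i j → i' ≤ i → j ≤ j' →
      IsCornerOf M χ i' j' := fun M _ _ _ _ h hi hj => h.mono hi hj
  refine ⟨fun M => moveOnes M (symmCells (cornerOnes M χ))
    (symmCells (Φ (IsCornerOf M χ) (cornerOnes M χ))), fun M hM hsymm => ?_⟩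
  obtain ⟨h1, h2, h3, h4, h5, h6, h7⟩ := hΦ _ (hmono M) (cornerOnes M χ) (fun i j h => h.1)
    (fun i j j' h h' => hM.row_unique (by simp [h.2]) (by simp [h'.2]) (i := i))
    (fun i i' j h h' => hM.col_unique (by simp [h.2]) (by simp [h'.2]) (j := j))
  have hsupp := symmCells_row_iff h5 h6
  have hone := eq_one_of_symmCells (χ := χ) hsymm
  have hF := moveOnes_isSignedPermMatrix hM hsymm symmCells_symm symmCells_symm hone
    (symmCells_unique hM hsymm h2 h3 h5 h6) hsupp
  have hF' := moveOnes_isSymm hsymm (symmCells_symm (T := cornerOnes M χ))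
    (symmCells_symm (T := Φ (IsCornerOf M χ) (cornerOnes M χ)))
  refine ⟨hF, hF', ?_, ?_⟩
  · beta_reduce
    rw [cornerOnes_moveOnes h1, isCornerOf_moveOnes h1, h4]
    exact moveOnes_moveOnes hM hone hsupp
  · rw [containsPattern_betaMat_iff hM hsymm hχ, containsPattern_one_iff hF hF' hχ,
      isCornerOf_moveOnes h1, cornerOnes_moveOnes h1]
    exact h7 k

end cornerOnes

/-- the patterns [[0,0,0,α_k],[0,0,χ,0],[0,χᵗ,0,0],[α_k,0,0,0]] and
[[0,0,0,β_k],[0,0,χ,0],[0,χᵗ,0,0],[β_k,0,0,0]] are I-Wilf equivalent. -/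
theorem stmt3 {k m : ℕ} (χ : Matrix (Fin m) (Fin m) ℤ) (hχ : IsSignedPermMatrix χ) :
    ∀ n : ℕ, 1 ≤ n →
      SIAvoidCount n (primePat (antiBlock2 (1 : Matrix (Fin k) (Fin k) ℤ) χ)) =
      SIAvoidCount n (primePat (antiBlock2 (betaMat k) χ)) := by
  intro n _
  cases k with
  | zero => rw [Subsingleton.elim (betaMat 0) 1]
  | succ k =>
    obtain ⟨F, hF⟩ := exists_matrix_involution n k hχ
    refine Set.ncard_congr (fun M _ => F M) ?_ ?_ ?_
    · rintro M ⟨hM, hsymm, h⟩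
      obtain ⟨h1, h2, h3, -⟩ := hF M hM hsymm
      refine ⟨h1, h2, ?_⟩
      rwa [(hF _ h1 h2).2.2.2, h3]
    · rintro M M' ⟨hM, hsymm, -⟩ ⟨hM', hsymm', -⟩ heq
      rw [← (hF M hM hsymm).2.2.1, ← (hF M' hM' hsymm').2.2.1]
      exact congrArg F heq
    · rintro M ⟨hM, hsymm, h⟩
      obtain ⟨h1, h2, h3, h4⟩ := hF M hM hsymm
      exact ⟨F M, ⟨h1, h2, by rwa [← h4]⟩, h3⟩
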